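/- Let ε > 0, let α ∈ 𝒦, and let γ ∈ ℝ. Then there exists a set 𝒢 ⊆ Bad with Hausdorff dimension dim_H(𝒢) = 1 such that for every β ∈ 𝒢 and every δ ∈ ℝ, there are infinitely many positive integers n with n · ‖nα − γ‖ · ‖nβ − δ‖ < (log log n)^(3+ε) / log n. -/

import Mathlib

open Real MeasureTheory Set

/-- Distance from `x` to the nearest integer. -/
noncomputable def nint (x : ℝ) : ℝ := ⨅ n : ℤ, |x - n|

/-- The set of badly approximable numbers. -/
def Bad : Set ℝ := {α : ℝ | ∃ c > 0, ∀ n : ℕ, 1 ≤ n → c ≤ n * nint (n * α)}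

/-- The set of `δ`-inhomogeneously badly approximable numbers. -/
def BadShift (δ : ℝ) : Set ℝ := {β : ℝ | ∃ c > 0, ∀ n : ℕ, 1 ≤ n → c ≤ n * nint (n * β - δ)}

/-- The set `ℬ = {(β, δ) : β ∈ Bad ∩ Bad(δ)}`. -/
def calB : Set (ℝ × ℝ) := {p : ℝ × ℝ | p.1 ∈ Bad ∧ p.1 ∈ BadShift p.2}

/-- The `k`-th continuant `q_k(α)` (denominator of the `k`-th convergent) of the
continued fraction expansion of `α`. -/
noncomputable def contDen (α : ℝ) (k : ℕ) : ℝ := (GenContFract.of α).dens k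

/-- `Λ(α) = sup_{k ≥ 1} (log q_k(α)) / k`. -/
noncomputable def Lam (α : ℝ) : ℝ := ⨆ k : ℕ+, Real.log (contDen α k) / k

/-- Membership in the set `𝒦` of irrational numbers with `Λ(α) < ∞`. -/
def memK (α : ℝ) : Prop :=
  Irrational α ∧ BddAbove (Set.range fun k : ℕ+ => Real.log (contDen α k) / k)

/-- The Fourier transform `μ̂(ξ) = ∫ e^{-2πiξx} dμ(x)` of a measure `μ` on `ℝ`. -/
noncomputable def mFT (μ : Measure ℝ) (ξ : ℝ) : ℂ :=
  ∫ x, Complex.exp (-(2 * Real.pi * ξ * x : ℝ) * Complex.I) ∂μ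

/-- Dispersion of a (finite) set `A ⊆ [0,1)`: the largest gap between circularly
consecutive elements, where the gap between the largest and the smallest element
wraps around, i.e. equals `min A + 1 - max A`. -/
noncomputable def disp (A : Set ℝ) : ℝ :=
  sSup {d : ℝ |
    (∃ a ∈ A, ∃ b ∈ A, a < b ∧ (∀ x ∈ A, x ≤ a ∨ b ≤ x) ∧ d = b - a) ∨
    (∃ a ∈ A, ∃ b ∈ A, (∀ x ∈ A, b ≤ x ∧ x ≤ a) ∧ d = b + 1 - a)}

/-- The closed `b`-adic interval of level `k` with left endpoint `a / b ^ k`. -/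
def Node (b k : ℕ) (a : ℤ) : Set ℝ := Icc ((a : ℝ) / (b : ℝ) ^ k) (((a : ℝ) + 1) / (b : ℝ) ^ k)

/-- `x` is `c`-badly approximable by fractions whose squared denominator lies in `[lo, hi)`. -/
def BadOn (c lo hi x : ℝ) : Prop :=
  ∀ q : ℕ, 0 < q → lo ≤ (q : ℝ) ^ 2 → (q : ℝ) ^ 2 < hi → ∀ p : ℤ, c ≤ q * |q * x - p|

theorem BadOn.mono {c c' lo lo' hi hi' x : ℝ} (h : BadOn c lo hi x) (hc : c' ≤ c) (hl : lo ≤ lo')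
    (hh : hi' ≤ hi) : BadOn c' lo' hi' x :=
  fun q hq h1 h2 p => hc.trans (h q hq (hl.trans h1) (h2.trans_le hh) p)

theorem BadOn.union {c lo mid hi x : ℝ} (h : BadOn c lo mid x) (h' : BadOn c mid hi x) :
    BadOn c lo hi x := fun q hq h1 h2 p =>
  (lt_or_ge ((q : ℝ) ^ 2) mid).elim (fun h3 => h q hq h1 h3 p) (fun h3 => h' q hq h3 h2 p)

theorem mem_node_iff {b k : ℕ} (hb : 0 < b) {a : ℤ} {x : ℝ} :
    x ∈ Node b k a ↔ (a : ℝ) ≤ x * (b : ℝ) ^ k ∧ x * (b : ℝ) ^ k ≤ a + 1 := by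
  have : (0 : ℝ) < (b : ℝ) ^ k := by positivity
  rw [Node, mem_Icc, div_le_iff₀ this, le_div_iff₀ this]

theorem node_abs_sub_le {b k : ℕ} (hb : 0 < b) {a : ℤ} {x y : ℝ} (hx : x ∈ Node b k a)
    (hy : y ∈ Node b k a) : |x - y| * (b : ℝ) ^ k ≤ 1 := by
  have : (0 : ℝ) < (b : ℝ) ^ k := by positivity
  rw [mem_node_iff hb] at hx hy
  rw [← abs_of_pos this, ← abs_mul, abs_le, sub_mul]
  constructor <;> linarith [hx.1, hx.2, hy.1, hy.2]

theorem node_sub_of_ediv {b : ℕ} (hb : 0 < b) {k j : ℕ} {a a' : ℤ} (h : a' / (b : ℤ) ^ j = a) :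
    Node b (k + j) a' ⊆ Node b k a := by
  intro x hx
  rw [mem_node_iff hb] at hx ⊢
  have hj : (0 : ℤ) < (b : ℤ) ^ j := by positivity
  have hjr : (0 : ℝ) < (b : ℝ) ^ j := by positivity
  have h1 : a * (b : ℤ) ^ j ≤ a' := by rw [← h]; exact Int.ediv_mul_le _ hj.ne'
  have h2 : a' + 1 ≤ (a + 1) * (b : ℤ) ^ j := by
    rw [← h]; exact Int.lt_ediv_add_one_mul_self _ hj
  have h1' : (a : ℝ) * (b : ℝ) ^ j ≤ a' := by exact_mod_cast h1
  have h2' : (a' : ℝ) + 1 ≤ (a + 1) * (b : ℝ) ^ j := by exact_mod_cast h2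
  rw [pow_add, ← mul_assoc] at hx
  constructor
  · refine le_of_mul_le_mul_right ?_ hjr
    linarith [hx.1]
  · refine le_of_mul_le_mul_right ?_ hjr
    linarith [hx.2]

/-- Distinct fractions are separated by the product of their denominators. -/
theorem one_le_mul_abs_sub_div {q q' : ℕ} (hq : 0 < q) (hq' : 0 < q') {p p' : ℤ}
    (h : (p : ℝ) / q ≠ p' / q') : 1 ≤ (q : ℝ) * q' * |(p : ℝ) / q - p' / q'| := by
  have h1 : (0 : ℝ) < q := by exact_mod_cast hq
  have h2 : (0 : ℝ) < q' := by exact_mod_cast hq'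
  have h3 : (q : ℝ) * q' * |(p : ℝ) / q - p' / q'| = |((p * q' - p' * q : ℤ) : ℝ)| := by
    rw [← abs_of_pos (mul_pos h1 h2), ← abs_mul]
    congr 1
    push_cast
    field_simp
  rw [h3]
  have : p * q' - p' * q ≠ 0 := by
    intro h0
    apply h
    rw [div_eq_div_iff h1.ne' h2.ne']
    have : p * q' = p' * q := by linarith
    exact_mod_cast this
  exact_mod_cast Int.one_le_abs this

theorem bad_child_adjacent {b k : ℕ} (hb : 2 ≤ b) {F c : ℝ} (hF : 0 < F)
    (hcF : c ≤ F / (2 * b)) {a : ℤ} {i j : ℕ} (hi : i < b) (hj : j < b)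
    (hbi : ¬ ∀ x ∈ Node b (k + 1) (b * a + i), BadOn c (F * b ^ k) (b ^ k / 3) x)
    (hbj : ¬ ∀ x ∈ Node b (k + 1) (b * a + j), BadOn c (F * b ^ k) (b ^ k / 3) x) :
    j ≤ i + 1 := by
  have key : ∀ i : ℕ, i < b →
      (¬ ∀ x ∈ Node b (k + 1) (b * a + i), BadOn c (F * b ^ k) (b ^ k / 3) x) →
      ∃ q : ℕ, 0 < q ∧ (q : ℝ) ^ 2 < b ^ k / 3 ∧ ∃ p : ℤ,
        (b * a + i : ℝ) - 1 / 2 < p / q * b ^ (k + 1) ∧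
        (p : ℝ) / q * b ^ (k + 1) < b * a + i + 1 + 1 / 2 := by
    intro i _ hbi
    simp only [BadOn] at hbi
    push Not at hbi
    obtain ⟨x, hx, q, hq, h1, h2, p, hp⟩ := hbi
    rw [mem_node_iff (by omega)] at hx
    push_cast at hx
    have hb0 : (0 : ℝ) < b := by exact_mod_cast (by omega : 0 < b)
    have hbk : (0 : ℝ) < (b : ℝ) ^ k := by positivity
    have hq0 : (0 : ℝ) < q := by exact_mod_cast hq
    have h3 : |x - p / q| * b ^ (k + 1) < 1 / 2 := by
      have e : (q : ℝ) * |q * x - p| = q ^ 2 * |x - p / q| := by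
        have : (q : ℝ) * x - p = q * (x - p / q) := by field_simp
        rw [this, abs_mul, abs_of_pos hq0]; ring
      rw [e] at hp
      have h4 : F * b ^ k * |x - p / q| < F / (2 * b) :=
        lt_of_le_of_lt (mul_le_mul_of_nonneg_right h1 (abs_nonneg _)) (hp.trans_le hcF)
      rw [lt_div_iff₀ (by positivity)] at h4
      have : F * (|x - p / q| * b ^ (k + 1)) < F * (1 / 2) := by
        rw [pow_succ]; linarith
      exact lt_of_mul_lt_mul_left this hF.le
    refine ⟨q, hq, h2, p, ?_⟩
    have hpos : (0 : ℝ) < (b : ℝ) ^ (k + 1) := by positivity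
    rw [← abs_of_pos hpos, ← abs_mul, abs_lt, sub_mul] at h3
    constructor <;> linarith [h3.1, h3.2, hx.1, hx.2]
  obtain ⟨q, hq, hqk, p, hp1, hp2⟩ := key i hi hbi
  obtain ⟨q', hq', hqk', p', hp1', hp2'⟩ := key j hj hbj
  have hb0 : (2 : ℝ) ≤ b := by exact_mod_cast hb
  have hbk : (0 : ℝ) < (b : ℝ) ^ k := by positivity
  have heq : (p : ℝ) / q = p' / q' := by
    by_contra hne
    have h1 := one_le_mul_abs_sub_div hq hq' hne
    have hqq : (q : ℝ) * q' < b ^ k / 3 := by nlinarith [sq_nonneg ((q : ℝ) - q')]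
    have h2 : |(p : ℝ) / q - p' / q'| * b ^ (k + 1) < b + 1 := by
      have hpos : (0 : ℝ) < (b : ℝ) ^ (k + 1) := by positivity
      have hi' : (i : ℝ) + 1 ≤ b := by exact_mod_cast hi
      have hj' : (j : ℝ) + 1 ≤ b := by exact_mod_cast hj
      have hi0 : (0 : ℝ) ≤ i := by positivity
      have hj0 : (0 : ℝ) ≤ j := by positivity
      rw [← abs_of_pos hpos, ← abs_mul, abs_lt, sub_mul]
      constructor <;> linarith
    have h3 : (q : ℝ) * q' * |(p : ℝ) / q - p' / q'| ≤ b ^ k / 3 * |(p : ℝ) / q - p' / q'| :=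
      mul_le_mul_of_nonneg_right hqq.le (abs_nonneg _)
    rw [pow_succ] at h2
    nlinarith
  rw [heq] at hp1 hp2
  have : (j : ℝ) < (i + 2 : ℕ) := by push_cast; linarith
  have := Nat.cast_lt.1 this
  omega

open Classical in
/-- All but at most two children of a `b`-adic interval avoid the fractions of the given size. -/
theorem free_children {b k : ℕ} (hb : 2 ≤ b) {F c : ℝ} (hF : 0 < F)
    (hcF : c ≤ F / (2 * b)) (a : ℤ) :
    b - 2 ≤ ((Finset.range b).filter fun i : ℕ =>
      ∀ x ∈ Node b (k + 1) (b * a + i), BadOn c (F * b ^ k) (b ^ k / 3) x).card := by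
  set P : ℕ → Prop := fun i : ℕ =>
      ∀ x ∈ Node b (k + 1) (b * a + i), BadOn c (F * b ^ k) (b ^ k / 3) x
  have h := Finset.card_filter_add_card_filter_not (s := Finset.range b) (p := P)
  rw [Finset.card_range] at h
  have h2 : ((Finset.range b).filter fun i => ¬ P i).card ≤ 2 := by
    rcases ((Finset.range b).filter fun i => ¬ P i).eq_empty_or_nonempty with he | hne
    · rw [he]; simp
    · set m := ((Finset.range b).filter fun i => ¬ P i).min' hne with hm
      have hmm := Finset.min'_mem _ hne
      rw [← hm, Finset.mem_filter, Finset.mem_range] at hmm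
      have : ((Finset.range b).filter fun i => ¬ P i) ⊆ {m, m + 1} := by
        intro j hj
        have h1 := Finset.min'_le _ j hj
        rw [Finset.mem_filter, Finset.mem_range] at hj
        have h2 := bad_child_adjacent hb hF hcF hmm.1 hj.1 hmm.2 hj.2
        rw [← hm] at h1
        simp only [Finset.mem_insert, Finset.mem_singleton]
        omega
      exact (Finset.card_le_card this).trans Finset.card_le_two
  change b - 2 ≤ ((Finset.range b).filter P).card
  omega

open Classical in
/-- Increasing enumeration of the vertices of a subtree of the `b`-adic tree in which every vertex
of level `k` has at least `N k` children. -/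
theorem tree_paths {b : ℕ} (hb : 0 < b) (Good : ℕ → ℤ → Prop) (N : ℕ → ℕ) (hN : ∀ k, 1 ≤ N k)
    (a₀ : ℤ) (h0 : Good 0 a₀)
    (hstep : ∀ k a, Good k a →
      N k ≤ ((Finset.range b).filter fun i : ℕ => Good (k + 1) (b * a + i)).card) :
    ∃ A : ℕ → ℕ → ℤ, A 0 0 = a₀ ∧
      (∀ K, ∀ r < ∏ k ∈ Finset.range K, N k, Good K (A K r)) ∧
      (∀ K r r', r < r' → r' < ∏ k ∈ Finset.range K, N k → A K r < A K r') ∧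
      (∀ K, ∀ r < ∏ k ∈ Finset.range (K + 1), N k, A (K + 1) r / b = A K (r / N K)) := by
  have he : ∀ k a, ∃ e : ℕ → ℕ, Good k a → ∀ i < N k, e i < b ∧ Good (k + 1) (b * a + e i) ∧
      ∀ j < i, e j < e i := by
    intro k a
    by_cases hg : Good k a
    · let s := (Finset.range b).filter fun i : ℕ => Good (k + 1) (b * a + i)
      let f := Finset.orderEmbOfCardLe s (hstep k a hg)
      refine ⟨fun i => if h : i < N k then f ⟨i, h⟩ else 0, fun _ i hi => ?_⟩
      simp only [hi, dite_true]
      have hm : f ⟨i, hi⟩ ∈ s := Finset.orderEmbOfCardLe_mem s (hstep k a hg) ⟨i, hi⟩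
      rw [Finset.mem_filter, Finset.mem_range] at hm
      refine ⟨hm.1, hm.2, fun j hj => ?_⟩
      have hj' : j < N k := hj.trans hi
      simp only [hj', dite_true]
      exact f.strictMono (by simpa using hj)
    · exact ⟨fun _ => 0, fun h => absurd h hg⟩
  choose e he using he
  let A : ℕ → ℕ → ℤ := fun K => Nat.rec (fun _ => a₀)
    (fun K AK r => b * AK (r / N K) + e K (AK (r / N K)) (r % N K)) K
  have hA : ∀ K r, A (K + 1) r = b * A K (r / N K) + e K (A K (r / N K)) (r % N K) :=
    fun K r => rfl
  have hdiv : ∀ K r, r < ∏ k ∈ Finset.range (K + 1), N k → r / N K < ∏ k ∈ Finset.range K, N k := by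
    intro K r hr
    rw [Finset.prod_range_succ] at hr
    exact Nat.div_lt_of_lt_mul (by rwa [mul_comm])
  have hgood : ∀ K, ∀ r < ∏ k ∈ Finset.range K, N k, Good K (A K r) := by
    intro K
    induction K with
    | zero => intro r _; exact h0
    | succ K ih =>
      intro r hr
      rw [hA]
      exact (he K _ (ih _ (hdiv K r hr)) _ (Nat.mod_lt _ (hN K))).2.1
  refine ⟨A, rfl, hgood, ?_, ?_⟩
  · intro K
    induction K with
    | zero => intro r r' h h'; simp at h'; omega
    | succ K ih =>
      intro r r' hrr hr'
      have hd := hdiv K r' hr'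
      have hd0 := hdiv K r (hrr.trans hr')
      rw [hA, hA]
      have e1 := he K _ (hgood K _ hd) _ (Nat.mod_lt r' (hN K))
      have e0 := he K _ (hgood K _ hd0) _ (Nat.mod_lt r (hN K))
      rcases (Nat.div_le_div_right hrr.le : r / N K ≤ r' / N K).lt_or_eq with h | h
      · have h1 := ih _ _ h hd
        have h2 : (e K (A K (r / N K)) (r % N K) : ℤ) < b := by exact_mod_cast e0.1
        have h3 : (b : ℤ) * (A K (r / N K) + 1) ≤ b * A K (r' / N K) :=
          mul_le_mul_of_nonneg_left h1 (by positivity)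
        have h4 : (0 : ℤ) ≤ e K (A K (r' / N K)) (r' % N K) := by positivity
        linarith
      · rw [h]
        have hmod : r % N K < r' % N K := by
          have := Nat.div_add_mod r (N K)
          have := Nat.div_add_mod r' (N K)
          rw [h] at *
          omega
        have := e1.2.2 _ hmod
        have : (e K (A K (r' / N K)) (r % N K) : ℤ) < e K (A K (r' / N K)) (r' % N K) := by
          exact_mod_cast this
        linarith
  · intro K r hr
    have e0 := he K _ (hgood K _ (hdiv K r hr)) _ (Nat.mod_lt r (hN K))
    rw [hA, add_comm, Int.add_mul_ediv_left _ _ (by omega),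
      Int.ediv_eq_zero_of_lt (by positivity) (by exact_mod_cast e0.1), zero_add]

open Classical in
/-- A subtree of the `b`-adic tree with at least `b ^ (σ K) / C` branches of length `K` carries a
set of dimension at least `σ`. -/
theorem le_dimH_of_tree {b : ℕ} (hb : 2 ≤ b) (Good : ℕ → ℤ → Prop) (N : ℕ → ℕ)
    (hN : ∀ k, 1 ≤ N k) (a₀ : ℤ) (h0 : Good 0 a₀)
    (hstep : ∀ k a, Good k a →
      N k ≤ ((Finset.range b).filter fun i : ℕ => Good (k + 1) (b * a + i)).card)
    {σ C : ℝ} (hσ : 0 < σ)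
    (hM : ∀ K : ℕ, (b : ℝ) ^ (σ * K) ≤ C * ((∏ k ∈ Finset.range K, N k : ℕ) : ℝ)) :
    ENNReal.ofReal σ ≤ dimH {x : ℝ | ∀ k, ∃ a, Good k a ∧ x ∈ Node b k a} := by
  obtain ⟨A, -, hgood, hmono, hdiv⟩ := tree_paths (by omega : 0 < b) Good N hN a₀ h0 hstep
  set M : ℕ → ℕ := fun K => ∏ k ∈ Finset.range K, N k with hMdef
  have hb0 : (0 : ℝ) < b := by positivity
  have hb1 : (1 : ℝ) < b := by exact_mod_cast (by omega : 1 < b)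
  have hMpos : ∀ K, 0 < M K := fun K => Finset.prod_pos fun k _ => hN k
  have hMpos' : ∀ K, (0 : ℝ) < M K := fun K => by exact_mod_cast hMpos K
  have hrank : ∀ v ∈ Ico (0 : ℝ) 1, ∀ K, ⌊v * M K⌋₊ < M K := by
    intro v hv K
    rw [Nat.floor_lt (mul_nonneg hv.1 (hMpos' K).le)]
    nlinarith [hMpos' K, hv.2]
  have hpi : ∀ v ∈ Ico (0 : ℝ) 1, ∃ x : ℝ, ∀ K, x ∈ Node b K (A K ⌊v * M K⌋₊) := by
    intro v hv
    have := IsCompact.nonempty_iInter_of_sequence_nonempty_isCompact_isClosed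
      (fun K => Node b K (A K ⌊v * M K⌋₊)) ?_ ?_ ?_ ?_
    · obtain ⟨x, hx⟩ := this
      exact ⟨x, fun K => mem_iInter.1 hx K⟩
    · intro K
      refine node_sub_of_ediv (j := 1) (by omega) ?_
      rw [pow_one, hdiv K _ (hrank v hv (K + 1)), ← Nat.floor_div_natCast]
      congr 2
      have : (N K : ℝ) ≠ 0 := by have := hN K; positivity
      simp only [hMdef, Finset.prod_range_succ]
      push_cast
      field_simp
    · intro K
      exact nonempty_Icc.2 (by gcongr; linarith)
    · exact isCompact_Icc
    · intro K; exact isClosed_Icc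
  choose! g hpt using hpi
  have hclose : ∀ v ∈ Ico (0 : ℝ) 1, ∀ w ∈ Ico (0 : ℝ) 1, ∀ K : ℕ, |g v - g w| * b ^ K ≤ 1 →
      |v - w| * M K ≤ 3 := by
    intro v hv w hw K hd
    have h1 := (mem_node_iff (by omega)).1 (hpt v hv K)
    have h2 := (mem_node_iff (by omega)).1 (hpt w hw K)
    have hbK : (0 : ℝ) < (b : ℝ) ^ K := by positivity
    rw [← abs_of_pos hbK, ← abs_mul, abs_le, sub_mul] at hd
    have hA : ∀ r r', r ≤ r' → r' < M K → A K r + (r' - r : ℕ) ≤ A K r' := by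
      intro r r' h h'
      induction r', h using Nat.le_induction with
      | base => simp
      | succ n hn ih =>
        have := ih (by omega)
        have := hmono K n (n + 1) (by omega) h'
        omega
    have hr : (⌊v * M K⌋₊ : ℤ) ≤ ⌊w * M K⌋₊ + 2 ∧ (⌊w * M K⌋₊ : ℤ) ≤ ⌊v * M K⌋₊ + 2 := by
      have k1 : A K ⌊v * M K⌋₊ ≤ A K ⌊w * M K⌋₊ + 2 := by
        have : (A K ⌊v * M K⌋₊ : ℝ) ≤ A K ⌊w * M K⌋₊ + 2 := by linarith [h1.1, h2.2, hd.2]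
        exact_mod_cast this
      have k2 : A K ⌊w * M K⌋₊ ≤ A K ⌊v * M K⌋₊ + 2 := by
        have : (A K ⌊w * M K⌋₊ : ℝ) ≤ A K ⌊v * M K⌋₊ + 2 := by linarith [h2.1, h1.2, hd.1]
        exact_mod_cast this
      rcases le_total ⌊v * M K⌋₊ ⌊w * M K⌋₊ with h | h
      · have := hA _ _ h (hrank w hw K); omega
      · have := hA _ _ h (hrank v hv K); omega
    have hr1 : (⌊v * M K⌋₊ : ℝ) ≤ ⌊w * M K⌋₊ + 2 := by exact_mod_cast hr.1
    have hr2 : (⌊w * M K⌋₊ : ℝ) ≤ ⌊v * M K⌋₊ + 2 := by exact_mod_cast hr.2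
    have f1 := Nat.floor_le (mul_nonneg hv.1 (hMpos' K).le)
    have f2 := Nat.floor_le (mul_nonneg hw.1 (hMpos' K).le)
    have f3 := Nat.lt_floor_add_one (v * M K)
    have f4 := Nat.lt_floor_add_one (w * M K)
    rw [← abs_of_pos (hMpos' K), ← abs_mul, abs_le, sub_mul]
    constructor <;> linarith
  have hCpos : 0 < C := by
    have h1 := hM 0
    have h2 : (0 : ℝ) < (b : ℝ) ^ (σ * (0 : ℕ)) := by positivity
    exact pos_of_mul_pos_left (h2.trans_le h1) (by positivity)
  have hclose' : ∀ v ∈ Ico (0 : ℝ) 1, ∀ w ∈ Ico (0 : ℝ) 1, ∀ K : ℕ, |g v - g w| * b ^ K ≤ 1 →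
      |v - w| * (b : ℝ) ^ (σ * K) ≤ 3 * C := by
    intro v hv w hw K h
    have h1 := hclose v hv w hw K h
    have h2 := mul_le_mul_of_nonneg_left (hM K) (abs_nonneg (v - w))
    nlinarith
  have hhol : ∀ v ∈ Ico (0 : ℝ) 1, ∀ w ∈ Ico (0 : ℝ) 1,
      |v - w| ≤ 3 * C * (b : ℝ) ^ σ * |g v - g w| ^ σ := by
    intro v hv w hw
    rcases (abs_nonneg (g v - g w)).eq_or_lt with hd | hd
    · rw [← hd, zero_rpow hσ.ne', mul_zero]
      by_contra hne
      push Not at hne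
      have ht : Filter.Tendsto (fun K : ℕ => |v - w| * ((b : ℝ) ^ σ) ^ K) Filter.atTop
          Filter.atTop :=
        (tendsto_pow_atTop_atTop_of_one_lt (one_lt_rpow hb1 hσ)).const_mul_atTop hne
      obtain ⟨K, hK⟩ := (ht.eventually_gt_atTop (3 * C)).exists
      have := hclose' v hv w hw K (by rw [← hd]; simp)
      rw [rpow_mul hb0.le, rpow_natCast] at this
      linarith
    · have hle : |g v - g w| ≤ 1 := by
        have h2 := hpt w hw 0
        have hM0 : M 0 = 1 := by simp [hMdef]
        have hv0 : ⌊v * M 0⌋₊ = ⌊w * M 0⌋₊ := by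
          have := hrank v hv 0
          have := hrank w hw 0
          omega
        rw [← hv0] at h2
        simpa using node_abs_sub_le (by omega) (hpt v hv 0) h2
      obtain ⟨K, hK1, hK2⟩ := exists_nat_pow_near_of_lt_one hd hle (inv_pos.2 hb0)
        (inv_lt_one_of_one_lt₀ hb1)
      have hbK : (0 : ℝ) < (b : ℝ) ^ K := by positivity
      rw [inv_pow, ← one_div, le_div_iff₀ hbK] at hK2
      have h1 := hclose' v hv w hw K hK2
      have h2 : 1 ≤ (b : ℝ) ^ (σ * K) * ((b : ℝ) ^ σ * |g v - g w| ^ σ) := by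
        have h3 : 1 ≤ b ^ (K + 1) * |g v - g w| := by
          rw [inv_pow, inv_lt_iff_one_lt_mul₀ (by positivity)] at hK1
          linarith
        calc (1 : ℝ) = 1 ^ σ := (one_rpow _).symm
          _ ≤ (b ^ (K + 1) * |g v - g w|) ^ σ := rpow_le_rpow (by norm_num) h3 hσ.le
          _ = _ := by
            rw [mul_rpow (by positivity) hd.le, ← mul_assoc, ← rpow_add hb0, ← rpow_natCast,
              ← rpow_mul hb0.le]
            congr 2
            push_cast
            ring
      calc |v - w| = |v - w| * 1 := (mul_one _).symm
        _ ≤ |v - w| * ((b : ℝ) ^ (σ * K) * ((b : ℝ) ^ σ * |g v - g w| ^ σ)) :=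
          mul_le_mul_of_nonneg_left h2 (abs_nonneg _)
        _ = |v - w| * (b : ℝ) ^ (σ * K) * ((b : ℝ) ^ σ * |g v - g w| ^ σ) := by ring
        _ ≤ 3 * C * ((b : ℝ) ^ σ * |g v - g w| ^ σ) := by gcongr
        _ = _ := by ring
  have hinj : InjOn g (Ico (0 : ℝ) 1) := by
    intro v hv w hw h
    have := hhol v hv w hw
    rw [h, sub_self, abs_zero, zero_rpow hσ.ne', mul_zero] at this
    exact sub_eq_zero.1 (abs_eq_zero.1 (le_antisymm this (abs_nonneg _)))
  set f := Function.invFunOn g (Ico (0 : ℝ) 1)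
  have hf : ∀ v ∈ Ico (0 : ℝ) 1, f (g v) = v := fun v hv => hinj.leftInvOn_invFunOn hv
  have himg : f '' (g '' Ico (0 : ℝ) 1) = Ico 0 1 := hinj.leftInvOn_invFunOn.image_image
  have hH : HolderOnWith (3 * C * (b : ℝ) ^ σ).toNNReal σ.toNNReal f (g '' Ico (0 : ℝ) 1) := by
    rintro _ ⟨v, hv, rfl⟩ _ ⟨w, hw, rfl⟩
    rw [hf v hv, hf w hw, Real.coe_toNNReal _ hσ.le, edist_dist, edist_dist, Real.dist_eq,
      Real.dist_eq, ENNReal.ofReal_rpow_of_nonneg (abs_nonneg _) hσ.le]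
    change _ ≤ ENNReal.ofReal _ * _
    rw [← ENNReal.ofReal_mul (by positivity)]
    exact ENNReal.ofReal_le_ofReal (hhol v hv w hw)
  have h1 := hH.dimH_image_le (by simpa using hσ)
  have hI : dimH (Ico (0 : ℝ) 1) = 1 := by
    rw [Real.dimH_of_nonempty_interior ⟨(1 / 2 : ℝ), by rw [interior_Ico, mem_Ioo]; norm_num⟩]
    simp
  rw [himg, hI, ENNReal.le_div_iff_mul_le (Or.inl (by simpa using hσ)) (Or.inl (by simp)),
    one_mul] at h1
  refine h1.trans (dimH_mono ?_)
  rintro _ ⟨v, hv, rfl⟩ k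
  exact ⟨_, hgood k _ (hrank v hv k), hpt v hv k⟩

/-- The additive character `x ↦ exp (2 π i x)`. -/
noncomputable def ex (x : ℝ) : ℂ := Complex.exp ((2 * π * x : ℝ) * Complex.I)

theorem ex_add (x y : ℝ) : ex (x + y) = ex x * ex y := by
  rw [ex, ex, ex, ← Complex.exp_add]
  congr 1
  push_cast
  ring

theorem norm_ex (x : ℝ) : ‖ex x‖ = 1 := Complex.norm_exp_ofReal_mul_I _

theorem ex_zero : ex 0 = 1 := by simp [ex]

theorem conj_ex (x : ℝ) : (starRingEnd ℂ) (ex x) = ex (-x) := by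
  rw [ex, ex, ← Complex.exp_conj]
  congr 1
  rw [map_mul, Complex.conj_ofReal, Complex.conj_I]
  push_cast
  ring

theorem ex_int (n : ℤ) : ex n = 1 := by
  rw [ex, Complex.exp_eq_one_iff]
  exact ⟨n, by push_cast; ring⟩

theorem ex_natCast_mul (n : ℕ) (x : ℝ) : ex (n * x) = ex x ^ n := by
  rw [ex, ex, ← Complex.exp_nat_mul]
  congr 1
  push_cast
  ring

theorem le_norm_ex_sub_one {x r : ℝ} (h : ∀ j : ℤ, r ≤ |x - j|) :
    4 * r ≤ ‖ex x - 1‖ := by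
  have h1 : ex x = ex (x - round x) := by
    have : x = (x - round x) + (round x : ℤ) := by ring
    rw [this, ex_add, ex_int, mul_one]
    simp
  set y := x - round x with hy
  have hy2 : |y| ≤ 1 / 2 := abs_sub_round x
  have hyr : r ≤ |y| := h (round x)
  have h2 : ‖ex y - 1‖ = 2 * |sin (π * y)| := by
    have := Complex.norm_exp_I_mul_ofReal_sub_one (2 * π * y)
    rw [mul_comm] at this
    rw [ex, this, Real.norm_eq_abs, abs_mul, abs_two]
    congr 3
    ring
  have h3 : |sin (π * y)| = sin (π * |y|) := by
    have : 0 ≤ sin (π * |y|) := sin_nonneg_of_nonneg_of_le_pi (by positivity)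
      (by nlinarith [pi_pos])
    rcases abs_cases y with ⟨h, _⟩ | ⟨h, _⟩
    · rw [h] at this ⊢; exact abs_of_nonneg this
    · rw [h] at this ⊢
      rw [mul_neg, sin_neg] at this ⊢
      exact abs_of_nonpos (by linarith)
  have h4 := mul_le_sin (x := π * |y|) (by positivity) (by nlinarith [pi_pos])
  rw [h1, h2, h3]
  have h5 : 2 / π * (π * |y|) = 2 * |y| := by field_simp
  linarith

theorem norm_sum_ex_sq_le {x r : ℝ} (hr : 0 < r) (h : ∀ j : ℤ, r ≤ |x - j|) (n : ℕ) :
    ‖∑ j ∈ Finset.range n, ex (j * x)‖ ^ 2 * (4 * r ^ 2) ≤ 1 := by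
  have h1 := le_norm_ex_sub_one h
  have h2 : ‖∑ j ∈ Finset.range n, ex (j * x)‖ * ‖ex x - 1‖ ≤ 2 := by
    simp_rw [ex_natCast_mul]
    rw [← norm_mul, geom_sum_mul, ← ex_natCast_mul]
    refine (norm_sub_le _ _).trans ?_
    rw [norm_ex, norm_one]; norm_num
  have h3 : ‖∑ j ∈ Finset.range n, ex (j * x)‖ * (4 * r) ≤ 2 :=
    (mul_le_mul_of_nonneg_left h1 (norm_nonneg _)).trans h2
  have h4 : 0 ≤ ‖∑ j ∈ Finset.range n, ex (j * x)‖ * (4 * r) := by positivity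
  nlinarith

/-- A finite family whose first exponential sums are small is dense modulo one. -/
theorem exists_close_of_norm_sum_ex_le {ι : Type*} (W : Finset ι) (hW : W.Nonempty) (θ : ι → ℝ)
    {n : ℕ} {r : ℝ} (hr : 0 < r) (hnr : 1 ≤ n * r ^ 2)
    (h : ∀ k : ℕ, 1 ≤ k → k ≤ n → ‖∑ w ∈ W, ex (k * θ w)‖ ≤ W.card / (2 * n)) (t : ℝ) :
    ∃ w ∈ W, ∃ j : ℤ, |θ w - t - j| < r := by
  by_contra hcon
  push Not at hcon
  have hR : (0 : ℝ) < W.card := by exact_mod_cast hW.card_pos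
  have hn : 0 < n := by
    rcases Nat.eq_zero_or_pos n with h | h
    · rw [h] at hnr; norm_num at hnr
    · exact h
  have hn' : (0 : ℝ) < n := by exact_mod_cast hn
  have hup : ∑ w ∈ W, ‖∑ j ∈ Finset.range n, ex (j * (θ w - t))‖ ^ 2 * (4 * r ^ 2) ≤
      (W.card : ℝ) := by
    have := Finset.sum_le_sum fun w hw => norm_sum_ex_sq_le hr (hcon w hw) n
    simpa using this
  have hZ : ∀ k : ℤ, k ≠ 0 → k.natAbs ≤ n →
      ‖∑ w ∈ W, ex (k * (θ w - t))‖ ≤ W.card / (2 * n) := by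
    intro k hk hkn
    have e1 : ∑ w ∈ W, ex (k * (θ w - t)) = ex (-(k * t)) * ∑ w ∈ W, ex (k * θ w) := by
      rw [Finset.mul_sum]
      refine Finset.sum_congr rfl fun w _ => ?_
      rw [← ex_add]; congr 1; ring
    rw [e1, norm_mul, norm_ex, one_mul]
    have h1 := h k.natAbs (Int.natAbs_pos.2 hk) hkn
    have hc : ((k.natAbs : ℕ) : ℝ) = |(k : ℝ)| := by
      rw [← Int.cast_natCast, Int.natCast_natAbs, Int.cast_abs]
    rw [hc] at h1
    rcases abs_cases (k : ℝ) with ⟨h2, _⟩ | ⟨h2, _⟩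
    · rwa [h2] at h1
    · rw [h2] at h1
      have e2 : (starRingEnd ℂ) (∑ w ∈ W, ex (k * θ w)) = ∑ w ∈ W, ex (-(k : ℝ) * θ w) := by
        rw [map_sum]
        refine Finset.sum_congr rfl fun w _ => ?_
        rw [conj_ex]; congr 1; ring
      rw [← e2, Complex.norm_conj] at h1
      exact h1
  have hexp : ∀ x : ℝ, ((‖∑ j ∈ Finset.range n, ex (j * x)‖ ^ 2 : ℝ) : ℂ) =
      ∑ j ∈ Finset.range n, ∑ l ∈ Finset.range n, ex (((j : ℤ) - (l : ℤ) : ℤ) * x) := by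
    intro x
    rw [Complex.ofReal_pow, ← Complex.mul_conj', map_sum, Finset.sum_mul_sum]
    refine Finset.sum_congr rfl fun j _ => Finset.sum_congr rfl fun l _ => ?_
    rw [conj_ex, ← ex_add]
    congr 1; push_cast; ring
  have htot : ((∑ w ∈ W, ‖∑ j ∈ Finset.range n, ex (j * (θ w - t))‖ ^ 2 : ℝ) : ℂ) =
      ∑ j ∈ Finset.range n, ∑ l ∈ Finset.range n,
        ∑ w ∈ W, ex (((j : ℤ) - (l : ℤ) : ℤ) * (θ w - t)) := by
    rw [Complex.ofReal_sum, Finset.sum_congr rfl fun w _ => hexp (θ w - t), Finset.sum_comm]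
    refine Finset.sum_congr rfl fun j _ => ?_
    rw [Finset.sum_comm]
  set T := ∑ w ∈ W, ‖∑ j ∈ Finset.range n, ex (j * (θ w - t))‖ ^ 2 with hT
  have hlow : ‖(T : ℂ) - n * W.card‖ ≤ n * (n * (W.card / (2 * n))) := by
    have e1 : (T : ℂ) - n * W.card = ∑ j ∈ Finset.range n, ((∑ l ∈ Finset.range n,
        ∑ w ∈ W, ex (((j : ℤ) - (l : ℤ) : ℤ) * (θ w - t))) - W.card) := by
      rw [Finset.sum_sub_distrib, ← htot]; simp
    rw [e1]
    refine (norm_sum_le_of_le (Finset.range n) (n := fun _ => n * ((W.card : ℝ) / (2 * n)))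
      ?_).trans (by simp)
    intro j hj
    have e2 : (∑ l ∈ Finset.range n, ∑ w ∈ W, ex (((j : ℤ) - (l : ℤ) : ℤ) * (θ w - t)))
        - (W.card : ℂ) = ∑ l ∈ (Finset.range n).erase j,
          ∑ w ∈ W, ex (((j : ℤ) - (l : ℤ) : ℤ) * (θ w - t)) := by
      rw [← Finset.add_sum_erase _ _ hj]
      simp [ex_zero]
    rw [e2]
    refine (norm_sum_le_of_le _ (n := fun _ => (W.card : ℝ) / (2 * n)) ?_).trans ?_
    · intro l hl
      rw [Finset.mem_erase, Finset.mem_range] at hl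
      rw [Finset.mem_range] at hj
      exact hZ _ (by omega) (by omega)
    · rw [Finset.sum_const, nsmul_eq_mul]
      gcongr
      exact_mod_cast (Finset.card_erase_le).trans (by simp)
  have hlow2 : (n : ℝ) * W.card / 2 ≤ T := by
    have e3 : (T : ℂ) - n * W.card = ((T - n * W.card : ℝ) : ℂ) := by push_cast; ring
    rw [e3, Complex.norm_real, Real.norm_eq_abs, abs_le] at hlow
    have e4 : (n : ℝ) * (n * (W.card / (2 * n))) = n * W.card / 2 := by field_simp
    linarith [hlow.1]
  rw [← Finset.sum_mul, ← hT] at hup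
  have h1 : (n : ℝ) * W.card / 2 * (4 * r ^ 2) ≤ W.card :=
    (mul_le_mul_of_nonneg_right hlow2 (by positivity)).trans hup
  nlinarith

theorem hasDerivAt_ex (x : ℝ) : HasDerivAt ex (2 * π * Complex.I * ex x) x := by
  have h : HasDerivAt (fun x : ℝ => ((2 * π * x : ℝ) : ℂ) * Complex.I)
      (((2 * π * 1 : ℝ) : ℂ) * Complex.I) x :=
    (((hasDerivAt_id x).const_mul (2 * π)).ofReal_comp).mul_const _
  refine h.cexp.congr_deriv ?_
  rw [ex]
  push_cast
  ring

theorem continuous_ex : Continuous ex :=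
  continuous_iff_continuousAt.2 fun x => (hasDerivAt_ex x).continuousAt

/-- Van der Corput type estimate for an oscillatory integral without stationary point. -/
theorem norm_integral_ex_le {f f' f'' : ℝ → ℝ} {p q lam mu : ℝ} (hpq : p ≤ q) (hlam : 0 < lam)
    (hf : ∀ y ∈ Icc p q, HasDerivAt f (f' y) y) (hf' : ∀ y ∈ Icc p q, HasDerivAt f' (f'' y) y)
    (hc : ContinuousOn f'' (Icc p q)) (hl : ∀ y ∈ Icc p q, lam ≤ |f' y|)
    (hm : ∀ y ∈ Icc p q, |f'' y| ≤ mu) :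
    ‖∫ y in p..q, ex (f y)‖ ≤ 2 / lam + (q - p) * (mu / lam ^ 2) := by
  have h0 : ∀ y ∈ Icc p q, f' y ≠ 0 := fun y hy h => by
    have := hl y hy; rw [h, abs_zero] at this; linarith
  have hmu : 0 ≤ mu := (abs_nonneg _).trans (hm p ⟨le_rfl, hpq⟩)
  set a : ℂ := (2 * π * Complex.I)⁻¹ with ha
  have hpi : (2 * π * Complex.I : ℂ) ≠ 0 := Complex.two_pi_I_ne_zero
  have hna : ‖a‖ ≤ 1 := by
    rw [ha, norm_inv, norm_mul, Complex.norm_I, norm_mul, Complex.norm_real, Real.norm_eq_abs,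
      abs_of_pos pi_pos, mul_one]
    refine inv_le_one_of_one_le₀ ?_
    simp only [Complex.norm_ofNat]
    nlinarith [pi_gt_three]
  clear_value a
  have hu : ∀ y ∈ uIcc p q, HasDerivAt (fun y => a * (((f' y)⁻¹ : ℝ) : ℂ))
      (a * ((-f'' y / f' y ^ 2 : ℝ) : ℂ)) y := by
    intro y hy
    rw [uIcc_of_le hpq] at hy
    exact (((hf' y hy).inv (h0 y hy)).ofReal_comp).const_mul a
  have hv : ∀ y ∈ uIcc p q, HasDerivAt (fun y => ex (f y)) (2 * π * Complex.I * ex (f y) * f' y) y := by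
    intro y hy
    rw [uIcc_of_le hpq] at hy
    have := (hasDerivAt_ex (f y)).scomp y (hf y hy)
    rw [Complex.real_smul, mul_comm] at this
    exact this
  have hfc : ContinuousOn f (Icc p q) := fun y hy => (hf y hy).continuousAt.continuousWithinAt
  have hfc' : ContinuousOn f' (Icc p q) := fun y hy => (hf' y hy).continuousAt.continuousWithinAt
  have hexc : ContinuousOn (fun y => ex (f y)) (Icc p q) := continuous_ex.comp_continuousOn hfc
  have hu' : IntervalIntegrable (fun y => a * ((-f'' y / f' y ^ 2 : ℝ) : ℂ)) volume p q := by
    refine ContinuousOn.intervalIntegrable ?_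
    rw [uIcc_of_le hpq]
    refine continuousOn_const.mul (Complex.continuous_ofReal.comp_continuousOn ?_)
    exact hc.neg.div (hfc'.pow 2) fun y hy => pow_ne_zero 2 (h0 y hy)
  have hv' : IntervalIntegrable (fun y => 2 * π * Complex.I * ex (f y) * f' y) volume p q := by
    refine ContinuousOn.intervalIntegrable ?_
    rw [uIcc_of_le hpq]
    exact (continuousOn_const.mul hexc).mul (Complex.continuous_ofReal.comp_continuousOn hfc')
  have hparts := intervalIntegral.integral_mul_deriv_eq_deriv_mul hu hv hu' hv'
  have e1 : ∫ y in p..q, ex (f y) = ∫ y in p..q, a * (((f' y)⁻¹ : ℝ) : ℂ) *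
      (2 * π * Complex.I * ex (f y) * f' y) := by
    refine intervalIntegral.integral_congr fun y hy => ?_
    rw [uIcc_of_le hpq] at hy
    have : (f' y : ℂ) ≠ 0 := by exact_mod_cast h0 y hy
    simp only [ha]
    push_cast
    field_simp
  rw [e1, hparts]
  have hb : ∀ y ∈ Icc p q, ‖a * (((f' y)⁻¹ : ℝ) : ℂ) * ex (f y)‖ ≤ 1 / lam := by
    intro y hy
    rw [norm_mul, norm_mul, norm_ex, mul_one, Complex.norm_real, norm_inv, Real.norm_eq_abs,
      one_div]
    calc ‖a‖ * |f' y|⁻¹ ≤ 1 * lam⁻¹ := by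
          gcongr
          exact hl y hy
      _ = lam⁻¹ := one_mul _
  have hintegral : ‖∫ y in p..q, a * ((-f'' y / f' y ^ 2 : ℝ) : ℂ) * ex (f y)‖ ≤
      (mu / lam ^ 2) * |q - p| := by
    refine intervalIntegral.norm_integral_le_of_norm_le_const fun y hy => ?_
    rw [uIoc_of_le hpq] at hy
    have hy' : y ∈ Icc p q := ⟨hy.1.le, hy.2⟩
    rw [norm_mul, norm_mul, norm_ex, mul_one, Complex.norm_real, norm_div, norm_neg, norm_pow,
      Real.norm_eq_abs, Real.norm_eq_abs]
    calc ‖a‖ * (|f'' y| / |f' y| ^ 2) ≤ 1 * (mu / lam ^ 2) := by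
          gcongr
          · exact hm y hy'
          · exact hl y hy'
      _ = _ := one_mul _
  rw [abs_of_nonneg (by linarith)] at hintegral
  refine (norm_sub_le _ _).trans ?_
  have := (norm_sub_le (a * (((f' q)⁻¹ : ℝ) : ℂ) * ex (f q)) (a * (((f' p)⁻¹ : ℝ) : ℂ) * ex (f p)))
  have h1 := hb p ⟨le_rfl, hpq⟩
  have h2 := hb q ⟨hpq, le_rfl⟩
  have e2 : 2 / lam = 1 / lam + 1 / lam := by ring
  rw [e2, mul_comm (q - p)]
  linarith

/-- The Möbius map `y ↦ (P y + P') / (Q y + Q')` with `P / Q = ξ` and `P Q' - P' Q = 1`. -/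
noncomputable def mob (ξ Q Q' y : ℝ) : ℝ := ξ - 1 / (Q * (Q * y + Q'))

theorem hasDerivAt_mob {ξ Q Q' y : ℝ} (hQ : Q ≠ 0) (hL : Q * y + Q' ≠ 0) :
    HasDerivAt (mob ξ Q Q') (1 / (Q * y + Q') ^ 2) y := by
  have h1 : HasDerivAt (fun y => Q * (Q * y + Q')) (Q * (Q * 1)) y :=
    (((hasDerivAt_id y).const_mul Q).add_const Q').const_mul Q
  have h2 := (h1.inv (mul_ne_zero hQ hL)).const_sub ξ
  have e : (fun y => ξ - (fun y => Q * (Q * y + Q'))⁻¹ y) = mob ξ Q Q' := by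
    funext y; simp [mob]
  rw [e] at h2
  refine h2.congr_deriv ?_
  field_simp

theorem hasDerivAt_mob' {Q Q' y : ℝ} (hL : Q * y + Q' ≠ 0) :
    HasDerivAt (fun y => 1 / (Q * y + Q') ^ 2) (-(2 * Q) / (Q * y + Q') ^ 3) y := by
  have h1 : HasDerivAt (fun y => (Q * y + Q') ^ 2) (2 * (Q * y + Q') * (Q * 1)) y := by
    have := (((hasDerivAt_id y).const_mul Q).add_const Q').fun_pow 2
    simpa using this
  have h2 := h1.inv (pow_ne_zero 2 hL)
  have e : (fun y => (Q * y + Q') ^ 2)⁻¹ = fun y => 1 / (Q * y + Q') ^ 2 := by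
    funext y; simp
  rw [e] at h2
  refine h2.congr_deriv ?_
  field_simp

theorem norm_integral_ex_mob_sub_le_of_sep {ξ Q Q' η R R' X Y M D p q : ℝ} (hX : 0 < X)
    (hQ : X ≤ Q) (hQ' : Q ≤ Q') (hQY : Q + Q' ≤ Y) (hR : X ≤ R) (hR' : R ≤ R') (hRY : R + R' ≤ Y)
    (hM : 0 < M) (hD : 0 < D) (hp : 0 ≤ p) (hpq : p ≤ q) (hq : q ≤ 1)
    (hsep : ∀ y ∈ Icc p q, D ≤ |(Q * y + Q') - (R * y + R')|) :
    ‖∫ y in p..q, ex (M * (mob ξ Q Q' y - mob η R R' y))‖ ≤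
      Y ^ 4 / (M * X * D) + Y ^ 8 / (M * X ^ 4 * D ^ 2) := by
  have hY : 0 < Y := by linarith
  have hL : ∀ y ∈ Icc p q, Q ≤ Q * y + Q' ∧ X ≤ Q * y + Q' ∧ Q * y + Q' ≤ Y := fun y hy => by
    have : 0 ≤ y := hp.trans hy.1
    have : y ≤ 1 := hy.2.trans hq
    refine ⟨?_, ?_, ?_⟩ <;> nlinarith
  have hK : ∀ y ∈ Icc p q, R ≤ R * y + R' ∧ X ≤ R * y + R' ∧ R * y + R' ≤ Y := fun y hy => by
    have : 0 ≤ y := hp.trans hy.1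
    have : y ≤ 1 := hy.2.trans hq
    refine ⟨?_, ?_, ?_⟩ <;> nlinarith
  have hL0 : ∀ y ∈ Icc p q, Q * y + Q' ≠ 0 := fun y hy => (hX.trans_le (hL y hy).2.1).ne'
  have hK0 : ∀ y ∈ Icc p q, R * y + R' ≠ 0 := fun y hy => (hX.trans_le (hK y hy).2.1).ne'
  have hQ0 : 0 < Q := hX.trans_le hQ
  have hR0 : 0 < R := hX.trans_le hR
  have hlam : 0 < M * (D * (2 * X) / Y ^ 4) := by positivity
  have main := norm_integral_ex_le (f := fun y => M * (mob ξ Q Q' y - mob η R R' y))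
    (f' := fun y => M * (1 / (Q * y + Q') ^ 2 - 1 / (R * y + R') ^ 2))
    (f'' := fun y => M * (-(2 * Q) / (Q * y + Q') ^ 3 - -(2 * R) / (R * y + R') ^ 3))
    (mu := M * (4 / X ^ 2)) hpq hlam
    (fun y hy => ((hasDerivAt_mob hQ0.ne' (hL0 y hy)).sub
      (hasDerivAt_mob hR0.ne' (hK0 y hy))).const_mul M)
    (fun y hy => ((hasDerivAt_mob' (hL0 y hy)).sub (hasDerivAt_mob' (hK0 y hy))).const_mul M)
    ?_ ?_ ?_
  · refine main.trans ?_
    have e1 : 2 / (M * (D * (2 * X) / Y ^ 4)) = Y ^ 4 / (M * X * D) := by field_simp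
    have e2 : M * (4 / X ^ 2) / (M * (D * (2 * X) / Y ^ 4)) ^ 2 = Y ^ 8 / (M * X ^ 4 * D ^ 2) := by
      field_simp; ring
    rw [e1, e2]
    gcongr
    refine mul_le_of_le_one_left (by positivity) (by linarith)
  · refine continuousOn_const.mul (ContinuousOn.sub ?_ ?_)
    · exact continuousOn_const.div (by fun_prop) fun y hy => pow_ne_zero 3 (hL0 y hy)
    · exact continuousOn_const.div (by fun_prop) fun y hy => pow_ne_zero 3 (hK0 y hy)
  · intro y hy
    have h1 := hL y hy
    have h2 := hK y hy
    have h3 := hsep y hy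
    set L := Q * y + Q'
    set K := R * y + R'
    have hLp : 0 < L := hX.trans_le h1.2.1
    have hKp : 0 < K := hX.trans_le h2.2.1
    rw [abs_mul, abs_of_pos hM]
    refine mul_le_mul_of_nonneg_left ?_ hM.le
    have e : 1 / L ^ 2 - 1 / K ^ 2 = -((L - K) * (L + K) / (L ^ 2 * K ^ 2)) := by
      field_simp; ring
    rw [e, abs_neg, abs_div, abs_mul, abs_of_pos (by positivity : 0 < L + K),
      abs_of_pos (by positivity : 0 < L ^ 2 * K ^ 2)]
    have e4 : Y ^ 4 = Y ^ 2 * Y ^ 2 := by ring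
    rw [e4]
    gcongr
    · linarith
    · exact h1.2.2
    · exact h2.2.2
  · intro y hy
    have h1 := hL y hy
    have h2 := hK y hy
    have key : ∀ A L : ℝ, 0 < A → A ≤ L → X ≤ L → |-(2 * A) / L ^ 3| ≤ 2 / X ^ 2 := by
      intro A L hA hAL hXL
      have hLp : 0 < L := hX.trans_le hXL
      rw [abs_div, abs_neg, abs_of_pos (by positivity : 0 < 2 * A),
        abs_of_pos (by positivity : 0 < L ^ 3)]
      calc 2 * A / L ^ 3 ≤ 2 * L / L ^ 3 := by gcongr
        _ = 2 / L ^ 2 := by field_simp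
        _ ≤ 2 / X ^ 2 := by gcongr
    rw [abs_mul, abs_of_pos hM]
    refine mul_le_mul_of_nonneg_left ((abs_sub _ _).trans ?_) hM.le
    have k1 := key _ _ hQ0 h1.1 h1.2.1
    have k2 := key _ _ hR0 h2.1 h2.2.1
    have e : 4 / X ^ 2 = 2 / X ^ 2 + 2 / X ^ 2 := by ring
    rw [e]
    exact add_le_add k1 k2

theorem norm_integral_ex_mob_sub_le {ξ Q Q' η R R' X Y M D w : ℝ} (hX : 0 < X)
    (hQ : X ≤ Q) (hQ' : Q ≤ Q') (hQY : Q + Q' ≤ Y) (hR : X ≤ R) (hR' : R ≤ R') (hRY : R + R' ≤ Y)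
    (hM : 0 < M) (hD : 0 < D) (hw : 0 < w) (hQR : D ≤ |Q - R|) :
    ‖∫ y in (0 : ℝ)..1, ex (M * (mob ξ Q Q' y - mob η R R' y))‖ ≤
      2 * w + 2 * (Y ^ 4 / (M * X * (D * w)) + Y ^ 8 / (M * X ^ 4 * (D * w) ^ 2)) := by
  have hY : 0 < Y := by linarith
  have hne : Q - R ≠ 0 := fun h => by rw [h, abs_zero] at hQR; linarith
  set z := -(Q' - R') / (Q - R) with hz
  have hlin : ∀ y, |(Q * y + Q') - (R * y + R')| = |Q - R| * |y - z| := by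
    intro y
    rw [← abs_mul, hz]
    congr 1
    field_simp
    ring
  set E := Y ^ 4 / (M * X * (D * w)) + Y ^ 8 / (M * X ^ 4 * (D * w) ^ 2) with hE
  have hEpos : 0 ≤ E := by positivity
  have hDw : 0 < D * w := by positivity
  have hcont : ContinuousOn (fun y => ex (M * (mob ξ Q Q' y - mob η R R' y))) (Icc 0 1) := by
    refine continuous_ex.comp_continuousOn (continuousOn_const.mul (ContinuousOn.sub ?_ ?_))
    · intro y hy
      exact (hasDerivAt_mob (by linarith) (by nlinarith [hy.1])).continuousAt.continuousWithinAt
    · intro y hy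
      exact (hasDerivAt_mob (by linarith) (by nlinarith [hy.1])).continuousAt.continuousWithinAt
  set p := max 0 (min 1 (z - w)) with hp
  set q := max 0 (min 1 (z + w)) with hq
  have hp0 : 0 ≤ p := le_max_left _ _
  have hp1 : p ≤ 1 := max_le zero_le_one (min_le_left _ _)
  have hq0 : 0 ≤ q := le_max_left _ _
  have hq1 : q ≤ 1 := max_le zero_le_one (min_le_left _ _)
  have hpq : p ≤ q := max_le_max le_rfl (min_le_min le_rfl (by linarith))
  have hpqw : q - p ≤ 2 * w := by
    simp only [hp, hq]
    rcases max_cases 0 (min 1 (z - w)) with h | h <;> rcases max_cases 0 (min 1 (z + w)) with h' | h' <;>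
    rcases min_cases 1 (z - w) with h2 | h2 <;> rcases min_cases 1 (z + w) with h3 | h3 <;> linarith
  have hii : ∀ a b, 0 ≤ a → a ≤ b → b ≤ 1 → IntervalIntegrable
      (fun y => ex (M * (mob ξ Q Q' y - mob η R R' y))) volume a b := by
    intro a b ha hab hb
    refine ContinuousOn.intervalIntegrable (hcont.mono ?_)
    rw [uIcc_of_le hab]
    exact Icc_subset_Icc ha hb
  rw [← intervalIntegral.integral_add_adjacent_intervals (hii 0 p le_rfl hp0 hp1)
    (hii p 1 hp0 hp1 le_rfl), ← intervalIntegral.integral_add_adjacent_intervals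
    (hii p q hp0 hpq hq1) (hii q 1 hq0 hq1 le_rfl)]
  have i1 : ‖∫ y in (0 : ℝ)..p, ex (M * (mob ξ Q Q' y - mob η R R' y))‖ ≤ E := by
    rcases hp0.eq_or_lt with h | h
    · rw [← h]; simpa using hEpos
    · refine norm_integral_ex_mob_sub_le_of_sep hX hQ hQ' hQY hR hR' hRY hM hDw le_rfl hp0 hp1 ?_
      intro y hy
      have : p ≤ z - w := by
        rcases max_cases 0 (min 1 (z - w)) with h' | h'
        · rw [hp, h'.1] at h; exact absurd h (lt_irrefl _)
        · rw [hp, h'.1]; exact min_le_right _ _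
      rw [hlin]
      gcongr
      rw [abs_of_nonpos (by linarith [hy.2])]
      linarith [hy.2]
  have i2 : ‖∫ y in p..q, ex (M * (mob ξ Q Q' y - mob η R R' y))‖ ≤ 2 * w := by
    have := intervalIntegral.norm_integral_le_of_norm_le_const (a := p) (b := q) (C := 1)
      (f := fun y => ex (M * (mob ξ Q Q' y - mob η R R' y))) fun y _ => (norm_ex _).le
    rw [abs_of_nonneg (by linarith), one_mul] at this
    exact this.trans hpqw
  have i3 : ‖∫ y in q..1, ex (M * (mob ξ Q Q' y - mob η R R' y))‖ ≤ E := by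
    rcases hq1.eq_or_lt with h | h
    · rw [h]; simpa using hEpos
    · refine norm_integral_ex_mob_sub_le_of_sep hX hQ hQ' hQY hR hR' hRY hM hDw hq0 hq1 le_rfl ?_
      intro y hy
      have : z + w ≤ q := by
        rcases min_cases 1 (z + w) with h' | h'
        · rw [hq, h'.1] at h; simp at h
        · rw [hq, h'.1]; exact le_max_right _ _
      rw [hlin]
      gcongr
      rw [abs_of_nonneg (by linarith [hy.1])]
      linarith [hy.1]
  refine (norm_add_le _ _).trans ?_
  refine (add_le_add le_rfl (norm_add_le _ _)).trans ?_
  linarith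

theorem card_mul_le_integral {n : ℕ} (hn : 0 < n) {g : ℝ → ℝ} (hc : ContinuousOn g (Icc 0 1))
    (h0 : ∀ y ∈ Icc (0 : ℝ) 1, 0 ≤ g y) {T : Finset ℕ} (hT : T ⊆ Finset.range n) {v : ℝ}
    (hv : ∀ a ∈ T, ∀ y ∈ Icc ((a : ℝ) / n) (((a : ℝ) + 1) / n), v ≤ g y) :
    T.card * (v / n) ≤ ∫ y in (0 : ℝ)..1, g y := by
  have hn' : (0 : ℝ) < n := by exact_mod_cast hn
  have hsub : ∀ a < n, Icc ((a : ℝ) / n) (((a + 1 : ℕ) : ℝ) / n) ⊆ Icc 0 1 := by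
    intro a ha
    refine Icc_subset_Icc (by positivity) ?_
    rw [div_le_one hn']
    exact_mod_cast ha
  have hle : ∀ a : ℕ, (a : ℝ) / n ≤ ((a + 1 : ℕ) : ℝ) / n := fun a => by gcongr; simp
  have hii : ∀ a < n, IntervalIntegrable g volume ((a : ℝ) / n) (((a + 1 : ℕ) : ℝ) / n) := by
    intro a ha
    refine ContinuousOn.intervalIntegrable (hc.mono ?_)
    rw [uIcc_of_le (hle a)]
    exact hsub a ha
  have hsum := intervalIntegral.sum_integral_adjacent_intervals (μ := volume) (f := g)
    (a := fun k : ℕ => (k : ℝ) / n) hii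
  simp only [Nat.cast_zero, zero_div, div_self hn'.ne'] at hsum
  rw [← hsum, ← nsmul_eq_mul, ← Finset.sum_const]
  refine (Finset.sum_le_sum fun a ha => ?_).trans
    (Finset.sum_le_sum_of_subset_of_nonneg hT fun a ha _ => ?_)
  · have ha' := Finset.mem_range.1 (hT ha)
    have : ∫ y in ((a : ℝ) / n)..(((a + 1 : ℕ) : ℝ) / n), v = v / n := by
      rw [intervalIntegral.integral_const, smul_eq_mul]
      push_cast
      field_simp
      ring
    rw [← this]
    refine intervalIntegral.integral_mono_on (hle a) intervalIntegrable_const (hii a ha') ?_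
    intro y hy
    refine hv a ha y ?_
    push_cast at hy
    exact hy
  · refine intervalIntegral.integral_nonneg (hle a) fun y hy => ?_
    exact h0 y (hsub a (Finset.mem_range.1 ha) hy)

theorem integral_norm_sum_ex_sq_le {ι : Type*} [DecidableEq ι] (W : Finset ι) {f : ι → ℝ → ℝ} {E : ℝ}
    (hc : ∀ w ∈ W, ContinuousOn (f w) (Icc 0 1))
    (hE : ∀ w ∈ W, ∀ v ∈ W, w ≠ v → ‖∫ y in (0 : ℝ)..1, ex (f w y - f v y)‖ ≤ E) (hE0 : 0 ≤ E) :
    ∫ y in (0 : ℝ)..1, ‖∑ w ∈ W, ex (f w y)‖ ^ 2 ≤ W.card + (W.card : ℝ) ^ 2 * E := by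
  have hexp : ∀ y : ℝ, ((‖∑ w ∈ W, ex (f w y)‖ ^ 2 : ℝ) : ℂ) =
      ∑ w ∈ W, ∑ v ∈ W, ex (f w y - f v y) := by
    intro x
    rw [Complex.ofReal_pow, ← Complex.mul_conj', map_sum, Finset.sum_mul_sum]
    refine Finset.sum_congr rfl fun j _ => Finset.sum_congr rfl fun l _ => ?_
    rw [conj_ex, ← ex_add, sub_eq_add_neg]
  have hii : ∀ w ∈ W, ∀ v ∈ W, IntervalIntegrable (fun y => ex (f w y - f v y)) volume 0 1 := by
    intro w hw v hv
    refine ContinuousOn.intervalIntegrable ?_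
    rw [uIcc_of_le zero_le_one]
    exact continuous_ex.comp_continuousOn ((hc w hw).sub (hc v hv))
  have h1 : ((∫ y in (0 : ℝ)..1, ‖∑ w ∈ W, ex (f w y)‖ ^ 2 : ℝ) : ℂ) =
      ∑ w ∈ W, ∑ v ∈ W, ∫ y in (0 : ℝ)..1, ex (f w y - f v y) := by
    rw [← intervalIntegral.integral_ofReal]
    simp_rw [hexp]
    rw [intervalIntegral.integral_finsetSum]
    · refine Finset.sum_congr rfl fun w hw => ?_
      exact intervalIntegral.integral_finsetSum fun v hv => hii w hw v hv
    · intro w hw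
      have := IntervalIntegrable.sum W fun v hv => hii w hw v hv
      simpa only [Finset.sum_fn] using this
  have h2 : ‖((∫ y in (0 : ℝ)..1, ‖∑ w ∈ W, ex (f w y)‖ ^ 2 : ℝ) : ℂ)‖ ≤
      ∑ w ∈ W, (1 + W.card * E) := by
    rw [h1]
    refine norm_sum_le_of_le _ fun w hw => ?_
    rw [← Finset.add_sum_erase _ _ hw]
    refine (norm_add_le _ _).trans (add_le_add ?_ ?_)
    · simp [ex_zero]
    · refine (norm_sum_le_of_le _ (n := fun _ => E) fun v hv => ?_).trans ?_
      · rw [Finset.mem_erase] at hv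
        exact hE w hw v hv.2 hv.1.symm
      · rw [Finset.sum_const, nsmul_eq_mul]
        gcongr
        exact Finset.erase_subset _ _
  rw [Complex.norm_real] at h2
  refine (le_abs_self _).trans (h2.trans (le_of_eq ?_))
  rw [Finset.sum_const, nsmul_eq_mul]
  ring

theorem norm_ex_sub_ex_le (x y : ℝ) : ‖ex x - ex y‖ ≤ 2 * π * |x - y| := by
  have e : ex x - ex y = ex y * (ex (x - y) - 1) := by
    rw [mul_sub, ← ex_add, mul_one]; congr 2; ring
  rw [e, norm_mul, norm_ex, one_mul]
  have := Real.norm_exp_I_mul_ofReal_sub_one_le (x := 2 * π * (x - y))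
  rw [mul_comm Complex.I] at this
  refine this.trans (le_of_eq ?_)
  rw [Real.norm_eq_abs, abs_mul, abs_of_pos (by positivity)]

theorem mob_sub_mob {ξ Q Q' y z : ℝ} (hQ : Q ≠ 0) (hy : Q * y + Q' ≠ 0) (hz : Q * z + Q' ≠ 0) :
    mob ξ Q Q' y - mob ξ Q Q' z = (y - z) / ((Q * y + Q') * (Q * z + Q')) := by
  rw [mob, mob]
  field_simp
  ring

theorem abs_mob_sub_mob_le {ξ Q Q' X y z : ℝ} (hX : 0 < X) (hQ : X ≤ Q) (hQ' : Q ≤ Q')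
    (hy : 0 ≤ y) (hz : 0 ≤ z) : |mob ξ Q Q' y - mob ξ Q Q' z| ≤ |y - z| / X ^ 2 := by
  have h1 : X ≤ Q * y + Q' := by nlinarith
  have h2 : X ≤ Q * z + Q' := by nlinarith
  rw [mob_sub_mob (by linarith) (by linarith) (by linarith), abs_div, sq]
  refine div_le_div_of_nonneg_left (abs_nonneg _) (by positivity) ?_
  rw [abs_of_pos (mul_pos (by linarith) (by linarith))]
  exact mul_le_mul h1 h2 hX.le (by linarith)

/-- Among sufficiently many subintervals of `[0, 1]`, one contains a parameter at which all the
first exponential sums over the family of Möbius maps are small. -/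
theorem exists_small_expsums {ι : Type*} [DecidableEq ι] (W : Finset ι) (hW : W.Nonempty)
    {ξ Q Q' : ι → ℝ} {X Y D w m : ℝ} (hX : 0 < X) (hQ : ∀ i ∈ W, X ≤ Q i)
    (hQ' : ∀ i ∈ W, Q i ≤ Q' i) (hQY : ∀ i ∈ W, Q i + Q' i ≤ Y) (hm : 0 < m) (hD : 0 < D)
    (hw : 0 < w) (hsep : ∀ i ∈ W, ∀ j ∈ W, i ≠ j → D ≤ |Q i - Q j|)
    {H n : ℕ} (hH : 0 < H) (hn : 0 < n) {T : Finset ℕ} (hT : T ⊆ Finset.range n)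
    (hTcard : 16 * (H : ℝ) ^ 3 * (1 / W.card +
      (2 * w + 2 * (Y ^ 4 / (m * X * (D * w)) + Y ^ 8 / (m * X ^ 4 * (D * w) ^ 2)))) <
        T.card / n)
    (hlip : 8 * π * (H : ℝ) ^ 2 * m ≤ X ^ 2 * n) :
    ∃ a ∈ T, ∃ y ∈ Icc ((a : ℝ) / n) (((a : ℝ) + 1) / n), ∀ h : ℕ, 1 ≤ h → h ≤ H →
      ‖∑ i ∈ W, ex (h * (m * mob (ξ i) (Q i) (Q' i) y))‖ ≤ W.card / (2 * H) := by
  by_contra hcon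
  push Not at hcon
  have hn' : (0 : ℝ) < n := by exact_mod_cast hn
  have hH' : (0 : ℝ) < H := by exact_mod_cast hH
  have hR : (0 : ℝ) < W.card := by exact_mod_cast hW.card_pos
  have hY : 0 < Y := by
    obtain ⟨i, hi⟩ := hW
    linarith [hQ i hi, hQ' i hi, hQY i hi]
  set E := 2 * w + 2 * (Y ^ 4 / (m * X * (D * w)) + Y ^ 8 / (m * X ^ 4 * (D * w) ^ 2)) with hE
  have hE0 : 0 ≤ E := by positivity
  set S : ℕ → ℝ → ℂ := fun h y => ∑ i ∈ W, ex (h * (m * mob (ξ i) (Q i) (Q' i) y)) with hS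
  have hmc : ∀ i ∈ W, ContinuousOn (mob (ξ i) (Q i) (Q' i)) (Icc 0 1) := by
    intro i hi y hy
    have h1 := hQ i hi
    have h2 := hQ' i hi
    exact (hasDerivAt_mob (by linarith) (by nlinarith [hy.1])).continuousAt.continuousWithinAt
  have hSc : ∀ h, ContinuousOn (S h) (Icc 0 1) := fun h =>
    continuousOn_finsetSum _ fun i hi => continuous_ex.comp_continuousOn
      (continuousOn_const.mul (continuousOn_const.mul (hmc i hi)))
  have hms : ∀ h ∈ Finset.Icc 1 H, ∫ y in (0 : ℝ)..1, ‖S h y‖ ^ 2 ≤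
      W.card + (W.card : ℝ) ^ 2 * E := by
    intro h hh
    rw [Finset.mem_Icc] at hh
    have hh1 : (1 : ℝ) ≤ h := by exact_mod_cast hh.1
    refine integral_norm_sum_ex_sq_le W
      (fun i hi => continuousOn_const.mul (continuousOn_const.mul (hmc i hi))) ?_ hE0
    intro i hi j hj hij
    have key := norm_integral_ex_mob_sub_le (ξ := ξ i) (η := ξ j) (M := h * m) hX (hQ i hi)
      (hQ' i hi) (hQY i hi) (hQ j hj) (hQ' j hj) (hQY j hj) (by positivity) hD hw (hsep i hi j hj hij)
    have e : ∀ y, (h : ℝ) * (m * mob (ξ i) (Q i) (Q' i) y) - h * (m * mob (ξ j) (Q j) (Q' j) y) =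
        h * m * (mob (ξ i) (Q i) (Q' i) y - mob (ξ j) (Q j) (Q' j) y) := fun y => by ring
    simp_rw [e]
    refine key.trans ?_
    have hmm : m ≤ h * m := by nlinarith
    rw [hE]
    gcongr
  have hlow : ∀ a ∈ T, ∀ y ∈ Icc ((a : ℝ) / n) (((a : ℝ) + 1) / n),
      ((W.card : ℝ) / (4 * H)) ^ 2 ≤ ∑ h ∈ Finset.Icc 1 H, ‖S h y‖ ^ 2 := by
    intro a ha y hy
    have han : (a : ℝ) / n ≤ ((a : ℝ) + 1) / n := by gcongr; linarith
    obtain ⟨h, h1, h2, h3⟩ := hcon a ha ((a : ℝ) / n) ⟨le_rfl, han⟩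
    have hy0 : 0 ≤ y := le_trans (by positivity) hy.1
    have hdist : |(a : ℝ) / n - y| ≤ 1 / n := by
      rw [abs_le]
      have e : ((a : ℝ) + 1) / n = a / n + 1 / n := by ring
      have := hy.1
      have := hy.2
      have : (0 : ℝ) ≤ 1 / n := by positivity
      constructor <;> linarith
    have hL : ‖S h ((a : ℝ) / n) - S h y‖ ≤ W.card / (4 * H) := by
      simp only [hS]
      rw [← Finset.sum_sub_distrib]
      refine (norm_sum_le_of_le _ (n := fun _ => 1 / (4 * (H : ℝ))) fun i hi => ?_).trans ?_
      · refine (norm_ex_sub_ex_le _ _).trans ?_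
        have e : (h : ℝ) * (m * mob (ξ i) (Q i) (Q' i) (a / n)) - h * (m * mob (ξ i) (Q i) (Q' i) y) =
          h * m * (mob (ξ i) (Q i) (Q' i) (a / n) - mob (ξ i) (Q i) (Q' i) y) := by ring
        rw [e, abs_mul, abs_of_nonneg (by positivity)]
        calc 2 * π * (h * m * |mob (ξ i) (Q i) (Q' i) (a / n) - mob (ξ i) (Q i) (Q' i) y|)
            ≤ 2 * π * (H * m * ((1 / n) / X ^ 2)) := by
              gcongr
              refine (abs_mob_sub_mob_le hX (hQ i hi) (hQ' i hi) (by positivity) hy0).trans ?_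
              gcongr
          _ ≤ 1 / (4 * H) := by
              rw [le_div_iff₀ (by positivity)]
              have : 2 * π * (H * m * (1 / n / X ^ 2)) * (4 * H) =
                (8 * π * (H : ℝ) ^ 2 * m) / (X ^ 2 * n) := by field_simp; ring
              rw [this]
              exact div_le_one_of_le₀ hlip (by positivity)
      · rw [Finset.sum_const, nsmul_eq_mul]
        exact le_of_eq (by ring)
    have hSy : (W.card : ℝ) / (4 * H) ≤ ‖S h y‖ := by
      have h4 := norm_sub_norm_le (S h ((a : ℝ) / n)) (S h y)
      have e : (W.card : ℝ) / (2 * H) = W.card / (4 * H) + W.card / (4 * H) := by field_simp; ring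
      have h3' : (W.card : ℝ) / (2 * H) < ‖S h ((a : ℝ) / n)‖ := h3
      linarith
    calc ((W.card : ℝ) / (4 * H)) ^ 2 ≤ ‖S h y‖ ^ 2 := by gcongr
      _ ≤ _ := Finset.single_le_sum (f := fun h => ‖S h y‖ ^ 2) (fun _ _ => by positivity)
        (Finset.mem_Icc.2 ⟨h1, h2⟩)
  have hcS : ∀ h, ContinuousOn (fun y => ‖S h y‖ ^ 2) (Icc 0 1) := fun h => (hSc h).norm.pow 2
  have hup := card_mul_le_integral hn (g := fun y => ∑ h ∈ Finset.Icc 1 H, ‖S h y‖ ^ 2)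
    (continuousOn_finsetSum _ fun h _ => hcS h)
    (fun y _ => Finset.sum_nonneg fun _ _ => by positivity) hT hlow
  rw [intervalIntegral.integral_finsetSum fun h _ => ContinuousOn.intervalIntegrable
    (by rw [uIcc_of_le zero_le_one]; exact hcS h)] at hup
  have hup2 := hup.trans (Finset.sum_le_sum hms)
  rw [Finset.sum_const, nsmul_eq_mul, Nat.card_Icc, Nat.add_sub_cancel] at hup2
  have e1 : (T.card : ℝ) * (((W.card : ℝ) / (4 * H)) ^ 2 / n) =
      (T.card / n) * ((W.card : ℝ) ^ 2 / (16 * H ^ 2)) := by ring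
  have e2 : (H : ℝ) * (W.card + (W.card : ℝ) ^ 2 * E) =
      (16 * (H : ℝ) ^ 3 * (1 / W.card + E)) * ((W.card : ℝ) ^ 2 / (16 * H ^ 2)) := by
    field_simp
  rw [e1, e2] at hup2
  have := le_of_mul_le_mul_right hup2 (by positivity)
  linarith

theorem child_ediv {b : ℕ} {i : ℕ} (hi : i < b) (a : ℤ) : (b * a + i) / (b : ℤ) = a := by
  rw [add_comm, Int.add_mul_ediv_left _ _ (by omega),
    Int.ediv_eq_zero_of_lt (by positivity) (by exact_mod_cast hi), zero_add]

theorem child_ediv_pow {b : ℕ} {a a₀ : ℤ} {j i : ℕ} (hi : i < b)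
    (h : a / (b : ℤ) ^ j = a₀) : (b * a + i) / (b : ℤ) ^ (j + 1) = a₀ := by
  rw [pow_succ', ← Int.ediv_ediv_of_nonneg (by positivity), child_ediv hi, h]

/-- Every node has at least `(b - 2) ^ j` descendants after `j` steps which avoid all fractions of
the intermediate sizes. -/
theorem exists_descendants {b : ℕ} (hb : 3 ≤ b) (k j : ℕ) (a₀ : ℤ) :
    ∃ A : ℕ → ℤ, (∀ r r', r < r' → r' < (b - 2) ^ j → A r < A r') ∧
      ∀ r < (b - 2) ^ j, A r / (b : ℤ) ^ j = a₀ ∧ ∀ x ∈ Node b (k + j) (A r),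
        BadOn (1 / (6 * b ^ 2)) (b ^ k / (3 * b)) (b ^ (k + j) / (3 * b)) x := by
  classical
  have hb0 : (0 : ℝ) < b := by positivity
  have hstep : ∀ (j : ℕ) (a : ℤ), (a / (b : ℤ) ^ j = a₀ ∧ ∀ x ∈ Node b (k + j) a,
        BadOn (1 / (6 * b ^ 2)) (b ^ k / (3 * b)) (b ^ (k + j) / (3 * b)) x) →
      b - 2 ≤ ((Finset.range b).filter fun i : ℕ => (b * a + i) / (b : ℤ) ^ (j + 1) = a₀ ∧
        ∀ x ∈ Node b (k + (j + 1)) (b * a + i),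
        BadOn (1 / (6 * b ^ 2)) (b ^ k / (3 * b)) (b ^ (k + (j + 1)) / (3 * b)) x).card := by
    rintro j a ⟨ha, hbad⟩
    refine (free_children (k := k + j) (F := 1 / (3 * b)) (c := 1 / (6 * b ^ 2)) (by omega)
      (by positivity) (le_of_eq (by field_simp; norm_num)) a).trans (Finset.card_le_card ?_)
    intro i hi
    rw [Finset.mem_filter] at hi ⊢
    have hib := Finset.mem_range.1 hi.1
    refine ⟨hi.1, child_ediv_pow hib ha, fun x hx => ?_⟩
    have h1 : x ∈ Node b (k + j) a := by
      refine node_sub_of_ediv (j := 1) (by omega) ?_ hx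
      rw [pow_one, child_ediv hib]
    refine (hbad x h1).union ((hi.2 x hx).mono le_rfl ?_ ?_)
    · exact le_of_eq (by ring)
    · exact le_of_eq (by rw [← add_assoc, pow_succ]; field_simp)
  obtain ⟨A, -, h2, h3, -⟩ := tree_paths (by omega : 0 < b)
    (fun j a => a / (b : ℤ) ^ j = a₀ ∧ ∀ x ∈ Node b (k + j) a,
        BadOn (1 / (6 * b ^ 2)) (b ^ k / (3 * b)) (b ^ (k + j) / (3 * b)) x)
    (fun _ => b - 2) (fun _ => by omega) a₀
    ⟨by simp, fun x _ q _ h h' => absurd (h.trans_lt h') (by simp)⟩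
    (fun j a h => (hstep j a h).trans (le_of_eq (by congr)))
  simp only [Finset.prod_const, Finset.card_range] at h2 h3
  exact ⟨A j, h3 j, h2 j⟩

theorem exists_bezout {P : ℤ} {Q : ℕ} (hQ : 0 < Q) (h : IsCoprime P (Q : ℤ)) :
    ∃ P' Q' : ℤ, P * Q' - P' * Q = 1 ∧ (Q : ℤ) ≤ Q' ∧ Q' ≤ 2 * Q := by
  obtain ⟨u, v, huv⟩ := h
  have hQpos : (0 : ℤ) < Q := by exact_mod_cast hQ
  refine ⟨-v - P * (u / Q) + P, u % Q + Q, ?_, ?_, ?_⟩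
  · have := Int.emod_add_mul_ediv u Q
    have e : u % Q = u - Q * (u / Q) := by linarith
    rw [e]
    linear_combination huv
  · linarith [Int.emod_nonneg u hQpos.ne']
  · linarith [Int.emod_lt_of_pos u hQpos]

/-- A point with no good approximations by fractions of intermediate size is well approximated
by a reduced fraction whose denominator has exact order `x`. -/
theorem exists_frac {b : ℕ} (hb : 2 ≤ b) {x₀ x c lo : ℝ} (hx : 1 ≤ x)
    (h1 : BadOn (1 / (6 * b ^ 2)) lo (x ^ 2 / (3 * b)) x₀) (h2 : BadOn c 0 lo x₀)
    (hlo : lo ≤ (c * x) ^ 2) (hc : 0 < c) :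
    ∃ (P : ℤ) (Q : ℕ), 0 < Q ∧ IsCoprime P (Q : ℤ) ∧ x ≤ 2 * b * Q ∧ (Q : ℝ) ≤ 7 * b ^ 2 * x ∧
      |x₀ - P / Q| * x ^ 2 ≤ 1 / 4 := by
  have hb0 : (2 : ℝ) ≤ b := by exact_mod_cast hb
  set n := ⌈6 * (b : ℝ) ^ 2 * x⌉₊ with hn
  have hn1 : 6 * (b : ℝ) ^ 2 * x ≤ n := Nat.le_ceil _
  have hn2 : (n : ℝ) < 6 * (b : ℝ) ^ 2 * x + 1 := Nat.ceil_lt_add_one (by positivity)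
  have hx0 : 0 < x := by linarith
  have hbx : 0 < 6 * (b : ℝ) ^ 2 * x := by positivity
  have hnpos : 0 < n := by
    have : (0 : ℝ) < n := by linarith
    exact_mod_cast this
  obtain ⟨r, hr, hrn⟩ := Real.exists_rat_abs_sub_le_and_den_le x₀ hnpos
  set Q := r.den with hQ
  have hQ0 : 0 < Q := r.pos
  have hQr : (0 : ℝ) < Q := by exact_mod_cast hQ0
  have hrc : (r : ℝ) = r.num / Q := by rw [hQ]; exact_mod_cast (Rat.num_div_den r).symm
  rw [hrc] at hr
  have hQn : (Q : ℝ) ≤ n := by exact_mod_cast hrn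
  have happ : |x₀ - r.num / Q| * (6 * b ^ 2 * x * Q) < 1 := by
    rw [le_div_iff₀ (by positivity)] at hr
    rcases (abs_nonneg (x₀ - r.num / Q)).eq_or_lt with h | h
    · rw [← h]; simp
    · refine lt_of_lt_of_le ?_ hr
      gcongr
      linarith
  have happ2 : (Q : ℝ) * |Q * x₀ - r.num| * (6 * b ^ 2 * x) < Q := by
    have e : (Q : ℝ) * x₀ - r.num = Q * (x₀ - r.num / Q) := by field_simp
    rw [e, abs_mul, abs_of_pos hQr]
    nlinarith
  have hQlow : x ^ 2 / (3 * b) ≤ (Q : ℝ) ^ 2 := by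
    by_contra hcon
    push Not at hcon
    rcases lt_or_ge ((Q : ℝ) ^ 2) lo with h | h
    · have h3 := h2 Q hQ0 (by positivity) h r.num
      have h4 : c * (6 * b ^ 2 * x) < Q :=
        lt_of_le_of_lt (mul_le_mul_of_nonneg_right h3 hbx.le) happ2
      have h5 : (Q : ℝ) < c * x := by
        refine lt_of_pow_lt_pow_left₀ 2 (by positivity) (h.trans_le hlo)
      have : 0 < c * x := by positivity
      have : c * x * 1 ≤ c * x * (6 * b ^ 2) := by gcongr; nlinarith
      linarith
    · have h3 := h1 Q hQ0 h hcon r.num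
      have h4 : 1 / (6 * (b : ℝ) ^ 2) * (6 * b ^ 2 * x) < Q :=
        lt_of_le_of_lt (mul_le_mul_of_nonneg_right h3 hbx.le) happ2
      have e : 1 / (6 * (b : ℝ) ^ 2) * (6 * b ^ 2 * x) = x := by field_simp
      rw [e] at h4
      rw [lt_div_iff₀ (by positivity)] at hcon
      nlinarith [mul_pos hQr hQr]
  have hxQ : x ≤ 2 * b * Q := by
    refine le_of_sq_le_sq ?_ (by positivity) |> fun h => h
    rw [div_le_iff₀ (by positivity)] at hQlow
    nlinarith [sq_nonneg (Q : ℝ), mul_nonneg (sq_nonneg (Q : ℝ)) (by linarith : (0 : ℝ) ≤ b)]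
  refine ⟨r.num, Q, hQ0, ?_, hxQ, ?_, ?_⟩
  · exact Int.isCoprime_iff_gcd_eq_one.2 (by simpa [Int.gcd, Nat.Coprime] using r.reduced)
  · have : 1 ≤ (b : ℝ) ^ 2 * x := by nlinarith [one_le_pow₀ (by linarith : (1 : ℝ) ≤ b) (n := 2)]
    linarith
  · have h3 : |x₀ - r.num / Q| * (3 * b * x ^ 2) ≤ |x₀ - r.num / Q| * (6 * b ^ 2 * x * Q) := by
      refine mul_le_mul_of_nonneg_left ?_ (abs_nonneg _)
      have := mul_le_mul_of_nonneg_left hxQ (by positivity : (0 : ℝ) ≤ 3 * b * x)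
      nlinarith
    have h4 : 0 ≤ |x₀ - r.num / Q| * x ^ 2 := by positivity
    nlinarith

/-- Denominators of distinct fractions in a common short interval free of small fractions are
well separated. -/
theorem den_separation {ξ ξ' c V Z lo : ℝ} {P P' : ℤ} {Q Q' : ℕ} (hQ : 0 < Q) (hQ' : 0 < Q')
    (hξ : ξ = P / Q) (hξ' : ξ' = P' / Q') (hne : ξ ≠ ξ') (hbad : BadOn c 0 lo ξ')
    (hV : 0 < V) (hclose : |ξ - ξ'| * V ≤ 1) (hQZ : (Q : ℝ) ≤ Z) (hZV : Z < V)
    (hlo : (c * V / Z) ^ 2 ≤ lo) : c * V / Z ≤ |(Q : ℝ) - Q'| := by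
  have hQr : (0 : ℝ) < Q := by exact_mod_cast hQ
  have hQr' : (0 : ℝ) < Q' := by exact_mod_cast hQ'
  have hZ : 0 < Z := by linarith
  have hQξ : |(Q : ℝ) * ξ' - P| * V ≤ Z := by
    have e : (Q : ℝ) * ξ' - P = -(Q * (ξ - ξ')) := by rw [hξ]; field_simp; ring
    rw [e, abs_neg, abs_mul, abs_of_pos hQr]
    nlinarith
  set q : ℕ := ((Q : ℤ) - Q').natAbs with hq
  have hqr : (q : ℝ) = |(Q : ℝ) - Q'| := by
    rw [hq, ← Int.cast_natCast, Int.natCast_natAbs, Int.cast_abs]; push_cast; rfl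
  rcases Nat.eq_zero_or_pos q with h0 | hpos
  · exfalso
    have hQQ : Q = Q' := by omega
    have h1 := one_le_mul_abs_sub_div hQ hQ' (p := P) (p' := P') (by rw [← hξ, ← hξ']; exact hne)
    rw [← hξ, ← hξ', ← hQQ] at h1
    have e : (Q : ℝ) * Q * |ξ - ξ'| = Q * |(Q : ℝ) * ξ' - P| := by
      have e : (Q : ℝ) * ξ' - P = -(Q * (ξ - ξ')) := by rw [hξ]; field_simp; ring
      rw [e, abs_neg, abs_mul, abs_of_pos hQr]; ring
    have e2 : (Q : ℝ) * ξ' - P = ((P' - P : ℤ) : ℝ) := by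
      rw [hξ', hQQ]; push_cast; field_simp
    rw [e2] at hQξ
    have hPP : P' - P ≠ 0 := by
      intro h
      apply hne
      rw [hξ, hξ', hQQ]
      have : P = P' := by omega
      rw [this]
    have : (1 : ℝ) ≤ |((P' - P : ℤ) : ℝ)| := by exact_mod_cast Int.one_le_abs hPP
    nlinarith
  · rw [← hqr]
    rcases lt_or_ge ((q : ℝ) ^ 2) lo with h | h
    · have key : ∃ p : ℤ, |(q : ℝ) * ξ' - p| = |(Q : ℝ) * ξ' - P| := by
        have e : ((Q : ℝ) - Q') * ξ' - (P - P') = (Q : ℝ) * ξ' - P := by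
          rw [hξ']; field_simp; ring
        rcases abs_cases ((Q : ℝ) - Q') with ⟨h1, _⟩ | ⟨h1, _⟩
        · refine ⟨P - P', ?_⟩
          rw [hqr, h1, ← e]; push_cast; rfl
        · refine ⟨-(P - P'), ?_⟩
          rw [hqr, h1, ← e, ← abs_neg]; push_cast; congr 1; ring
      obtain ⟨p, hp⟩ := key
      have h1 := hbad q hpos (by positivity) h p
      rw [hp] at h1
      rw [div_le_iff₀ hZ]
      have hq0 : (0 : ℝ) ≤ q := by positivity
      calc c * V ≤ q * |(Q : ℝ) * ξ' - P| * V := by gcongr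
        _ = q * (|(Q : ℝ) * ξ' - P| * V) := by ring
        _ ≤ q * Z := by gcongr
    · exact le_of_sq_le_sq (hlo.trans h) (by positivity)

theorem abs_sub_mob_le {b : ℕ} (hb : 2 ≤ b) {x x₀ ξ Q Q' y : ℝ} (hx : 0 < x) (hQ : 0 < Q)
    (hQ' : Q ≤ Q') (hxQ : x ≤ 2 * b * Q) (hclose : |x₀ - ξ| * x ^ 2 ≤ 1 / 4) (hy : 0 ≤ y) :
    |x₀ - mob ξ Q Q' y| * x ^ 2 ≤ 5 * b ^ 2 := by
  have hb0 : (2 : ℝ) ≤ b := by exact_mod_cast hb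
  have hL : Q ≤ Q * y + Q' := by nlinarith
  have hLpos : 0 < Q * y + Q' := by linarith
  have e : x₀ - mob ξ Q Q' y = (x₀ - ξ) + 1 / (Q * (Q * y + Q')) := by rw [mob]; ring
  have h1 : 1 / (Q * (Q * y + Q')) * x ^ 2 ≤ 4 * b ^ 2 := by
    rw [div_mul_eq_mul_div, div_le_iff₀ (by positivity), one_mul]
    calc x ^ 2 ≤ (2 * b * Q) ^ 2 := by gcongr
      _ = 4 * b ^ 2 * (Q * Q) := by ring
      _ ≤ 4 * b ^ 2 * (Q * (Q * y + Q')) := by gcongr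
  rw [e]
  have h2 : |(x₀ - ξ) + 1 / (Q * (Q * y + Q'))| ≤ |x₀ - ξ| + 1 / (Q * (Q * y + Q')) := by
    refine (abs_add_le _ _).trans (le_of_eq ?_)
    rw [abs_of_pos (a := 1 / (Q * (Q * y + Q'))) (by positivity)]
  have h3 := mul_le_mul_of_nonneg_right h2 (sq_nonneg x)
  nlinarith

set_option maxHeartbeats 400000 in
/-- Badness of a point in continued fraction coordinates `y` below a convergent `P / Q`. -/
theorem badOn_mob {b : ℕ} (hb : 2 ≤ b) {x x₀ ξ y lo hi : ℝ} {P P' Q' : ℤ} {Q : ℕ} (hx : 0 < x)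
    (hQ : 0 < Q) (hξ : ξ = P / Q) (hdet : P * Q' - P' * Q = 1) (hQ' : (Q : ℤ) ≤ Q')
    (hQ'2 : Q' ≤ 2 * Q) (hxQ : x ≤ 2 * b * Q) (hQx : (Q : ℝ) ≤ 7 * b ^ 2 * x)
    (hclose : |x₀ - ξ| * x ^ 2 ≤ 1 / 4) (hy0 : 0 ≤ y) (hy1 : y ≤ 1)
    (hy : BadOn (1 / (6 * b ^ 2)) 0 hi y) (hx₀ : BadOn (1 / (6 * b ^ 2)) lo (x ^ 2 / (3 * b)) x₀) :
    BadOn (1 / (336 * b ^ 4)) lo (x ^ 2 * hi / (16 * b ^ 2)) (mob ξ Q Q' y) := by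
  have hb0 : (2 : ℝ) ≤ b := by exact_mod_cast hb
  have hb1 : (0 : ℝ) < b := by linarith
  have hQr : (0 : ℝ) < Q := by exact_mod_cast hQ
  have hQr' : (Q : ℝ) ≤ Q' := by exact_mod_cast hQ'
  have hQr'2 : (Q' : ℝ) ≤ 2 * Q := by exact_mod_cast hQ'2
  have hdetr : (P : ℝ) * Q' - P' * Q = 1 := by exact_mod_cast hdet
  have hfin : 1 / (336 * (b : ℝ) ^ 4) ≤ 1 / (6 * b ^ 2) / 2 := by
    rw [div_div]
    gcongr 1 / ?_
    have : (1 : ℝ) ≤ b ^ 2 := one_le_pow₀ (by linarith)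
    nlinarith [sq_nonneg (b : ℝ)]
  set L : ℝ := Q * y + Q' with hL
  have hLQ : (Q : ℝ) ≤ L := by rw [hL]; nlinarith
  have hL3 : L ≤ 3 * Q := by rw [hL]; nlinarith
  have hLpos : 0 < L := by linarith
  have hdist := abs_sub_mob_le hb hx hQr hQr' hxQ hclose hy0
  set β := mob ξ Q Q' y with hβ
  have hβ' : β = (P * y + P') / L := by
    rw [hβ, mob, ← hL, hξ]
    field_simp
    rw [hL]; linear_combination hdetr
  intro q hq hlo hhi p
  have hqr : (0 : ℝ) < q := by exact_mod_cast hq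
  rcases le_or_gt ((q : ℝ) * (8 * b ^ 2)) x with hcase | hcase
  · have hq2 : (q : ℝ) ^ 2 * (64 * b ^ 4) ≤ x ^ 2 := by
      calc (q : ℝ) ^ 2 * (64 * b ^ 4) = (q * (8 * b ^ 2)) ^ 2 := by ring
        _ ≤ x ^ 2 := by gcongr
    have h1 : 1 / (6 * (b : ℝ) ^ 2) ≤ q * |q * x₀ - p| := by
      refine hx₀ q hq hlo ?_ p
      rw [lt_div_iff₀ (by positivity)]
      refine lt_of_lt_of_le ?_ hq2
      gcongr (q : ℝ) ^ 2 * ?_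
      have : (1 : ℝ) ≤ b ^ 3 := one_le_pow₀ (by linarith)
      nlinarith
    have h2 : |(q : ℝ) * x₀ - p| ≤ |q * β - p| + q * |x₀ - β| := by
      have e : (q : ℝ) * x₀ - p = (q * β - p) + q * (x₀ - β) := by ring
      rw [e]
      refine (abs_add_le _ _).trans ?_
      rw [abs_mul (q : ℝ), abs_of_pos hqr]
    have h3 : (q : ℝ) ^ 2 * |x₀ - β| ≤ 1 / (6 * (b : ℝ) ^ 2) / 2 := by
      have h4 : (q : ℝ) ^ 2 * (64 * b ^ 4) * |x₀ - β| ≤ 5 * b ^ 2 := by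
        refine (mul_le_mul_of_nonneg_right hq2 (abs_nonneg _)).trans ?_
        linarith
      rw [div_div, le_div_iff₀ (by positivity)]
      have : 0 ≤ (q : ℝ) ^ 2 * |x₀ - β| := by positivity
      have h5 : (q : ℝ) ^ 2 * |x₀ - β| * (64 * b ^ 2) ≤ 5 := by
        refine le_of_mul_le_mul_right (a := (b : ℝ) ^ 2) ?_ (by positivity)
        linarith
      nlinarith [mul_nonneg this (sq_nonneg (b : ℝ))]
    have h6 := mul_le_mul_of_nonneg_left h2 hqr.le
    linarith
  · set q₀ : ℤ := P * q - Q * p with hq₀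
    set p₀ : ℤ := Q' * p - P' * q with hp₀
    set d : ℝ := q₀ * y - p₀ with hd
    have hqd : (q : ℝ) = q₀ * L - Q * d := by
      rw [hd, hL, hq₀, hp₀]; push_cast
      linear_combination (-(q : ℝ)) * hdetr
    have hval : (q : ℝ) * β - p = d / L := by
      rw [hβ', hd, hq₀, hp₀]
      field_simp
      rw [hL]; push_cast; ring
    rw [hval, abs_div, abs_of_pos hLpos, ← mul_div_assoc, le_div_iff₀ hLpos]
    rcases le_or_gt (1 / 2) |d| with hd2 | hd2
    · have h1 : L ≤ 168 * b ^ 4 * q := by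
        have : 3 * (7 * (b : ℝ) ^ 2 * x) ≤ 3 * (7 * b ^ 2 * (q * (8 * b ^ 2))) := by gcongr
        nlinarith
      rw [div_mul_eq_mul_div, div_le_iff₀ (by positivity)]
      have h2 : (q : ℝ) * (1 / 2) ≤ q * |d| := by gcongr
      have h3 : (q : ℝ) * (1 / 2) * (336 * b ^ 4) ≤ q * |d| * (336 * b ^ 4) := by gcongr
      linarith
    · have hdl := abs_lt.1 hd2
      have hQd : Q * d ≤ L / 2 := by
        linarith [mul_le_mul_of_nonneg_left hdl.2.le hQr.le]
      have hQd' : -(L / 2) ≤ Q * d := by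
        linarith [mul_le_mul_of_nonneg_left hdl.1.le hQr.le]
      have hq₀pos : 0 < q₀ := by
        by_contra hcon
        rcases lt_or_eq_of_le (not_lt.1 hcon) with h | h
        · have h' : (q₀ : ℝ) ≤ -1 := by exact_mod_cast (by omega : q₀ ≤ -1)
          linarith [mul_le_mul_of_nonneg_right h' hLpos.le]
        · have hd0 : d = -p₀ := by rw [hd, h]; simp
          have hp : p₀ = 0 := by
            rw [hd0, abs_neg] at hd2
            have : |(p₀ : ℝ)| < 1 := by linarith
            exact Int.abs_lt_one_iff.1 (by exact_mod_cast this)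
          rw [hd0, h, hp] at hqd
          simp at hqd
          omega
      have hq₀1 : (1 : ℝ) ≤ q₀ := by exact_mod_cast hq₀pos
      have hqL : q₀ * L / 2 ≤ q := by
        linarith [mul_le_mul_of_nonneg_right hq₀1 hLpos.le]
      lift q₀ to ℕ using hq₀pos.le with m hm
      have hmr : ((m : ℤ) : ℝ) = (m : ℝ) := by simp
      rw [hmr] at hd hqL
      have hm0 : 0 < m := by exact_mod_cast hq₀pos
      have hmx : (m : ℝ) * x ≤ 4 * b * q := by
        calc (m : ℝ) * x ≤ m * (2 * b * Q) := by gcongr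
          _ ≤ m * (2 * b * L) := by gcongr
          _ = 4 * b * (m * L / 2) := by ring
          _ ≤ 4 * b * q := mul_le_mul_of_nonneg_left hqL (by positivity)
      have h1 := hy m hm0 (by positivity) ?_ p₀
      · rw [← hd] at h1
        have h2 : 1 / (6 * (b : ℝ) ^ 2) * L ≤ m * |d| * L := by gcongr
        have h3 : m * L / 2 * |d| ≤ q * |d| := by gcongr
        have h4 : 1 / (336 * (b : ℝ) ^ 4) * L ≤ 1 / (6 * b ^ 2) / 2 * L := by gcongr
        linarith
      · rw [lt_div_iff₀ (by positivity)] at hhi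
        have h2 : ((m : ℝ) * x) ^ 2 ≤ (4 * b * q) ^ 2 := by gcongr
        refine lt_of_mul_lt_mul_right (a := x ^ 2) ?_ (by positivity)
        nlinarith

/-- All points of the node avoid fractions of every size visible at its scale. -/
def Adm (b k : ℕ) (a : ℤ) : Prop :=
  ∀ x ∈ Node b k a, BadOn (1 / (1344 * b ^ 5)) 0 (b ^ k / (3 * b)) x

/-- The numerical inequality behind the choice of scales. -/
theorem scale_inequality {b u : ℕ} (hb : 2048 ≤ b) (hu : 50 ≤ u) {E F : ℝ}
    (hE : E ≤ b ^ 21 / ((b : ℝ) ^ u) ^ 24) (hF : F ≤ b ^ 44 / ((b : ℝ) ^ u) ^ 8) :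
    16 * ((b : ℝ) ^ (2 * u)) ^ 3 * (1 / ((b - 2 : ℕ) : ℝ) ^ (8 * u) +
      (2 * (1 / (b : ℝ) ^ (8 * u)) + 2 * (E + F))) <
      ((b - 2 : ℕ) : ℝ) ^ (48 * u) / (b : ℝ) ^ (48 * u) := by
  have hb0 : (2048 : ℝ) ≤ b := by exact_mod_cast hb
  have hB : ((b - 2 : ℕ) : ℝ) = b - 2 := by push_cast [Nat.cast_sub (by omega : 2 ≤ b)]; ring
  rw [hB]
  have e1 : (b : ℝ) ^ (2 * u) = (b ^ u) ^ 2 := by ring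
  have e2 : (b : ℝ) ^ (8 * u) = (b ^ u) ^ 8 := by ring
  have e3 : (b : ℝ) ^ (48 * u) = (b ^ u) ^ 48 := by ring
  have e4 : ((b : ℝ) - 2) ^ (8 * u) = ((b - 2) ^ u) ^ 8 := by rw [mul_comm, pow_mul]
  have e5 : ((b : ℝ) - 2) ^ (48 * u) = ((b - 2) ^ u) ^ 48 := by rw [mul_comm, pow_mul]
  rw [e1, e2, e3, e4, e5]
  have hB56 : (b : ℝ) ^ 56 ≤ 2 * (b - 2) ^ 56 := by
    have h := one_add_mul_le_pow (a := -(2 / (b : ℝ))) (by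
      have : 2 / (b : ℝ) ≤ 1 := by rw [div_le_one (by linarith)]; linarith
      linarith) 56
    have h1 : (1 : ℝ) / 2 ≤ 1 + (56 : ℕ) * -(2 / (b : ℝ)) := by
      have : 2 / (b : ℝ) ≤ 1 / 112 := by
        rw [div_le_div_iff₀ (by linarith) (by norm_num)]; linarith
      push_cast; linarith
    have h2 : (1 + -(2 / (b : ℝ))) = (b - 2) / b := by field_simp; ring
    rw [h2, div_pow] at h
    have h3 := h1.trans h
    rw [le_div_iff₀ (by positivity)] at h3
    linarith
  have hg : ((b : ℝ) ^ u) ^ 56 ≤ 2 ^ u * ((b - 2) ^ u) ^ 56 := by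
    calc ((b : ℝ) ^ u) ^ 56 = ((b : ℝ) ^ 56) ^ u := by ring
      _ ≤ (2 * ((b : ℝ) - 2) ^ 56) ^ u := by gcongr
      _ = 2 ^ u * (((b : ℝ) - 2) ^ u) ^ 56 := by rw [mul_pow, ← pow_mul, ← pow_mul, mul_comm 56]
  have hhg : ((b : ℝ) - 2) ^ u ≤ b ^ u := by gcongr <;> linarith
  have hhpos : 0 < ((b : ℝ) - 2) ^ u := pow_pos (by linarith) _
  have hgp : ((2 : ℝ) ^ u) ^ 2 < b ^ u := by
    calc ((2 : ℝ) ^ u) ^ 2 = 4 ^ u := by rw [← pow_mul, mul_comm, pow_mul]; norm_num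
      _ < (b : ℝ) ^ u := pow_lt_pow_left₀ (by linarith) (by norm_num) (by omega)
  have hgb : 112 * (b : ℝ) ^ 44 ≤ b ^ u := by
    calc 112 * (b : ℝ) ^ 44 ≤ (b : ℝ) * (b : ℝ) ^ 44 := by gcongr; linarith
      _ = (b : ℝ) ^ 45 := by ring
      _ ≤ (b : ℝ) ^ u := pow_le_pow_right₀ (by linarith) (by omega)
  have hp1 : (1 : ℝ) ≤ 2 ^ u := one_le_pow₀ (by norm_num)
  have hbg : (b : ℝ) ^ 21 ≤ b ^ 44 := pow_le_pow_right₀ (by linarith) (by norm_num)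
  have hb44 : (1 : ℝ) ≤ b ^ 44 := one_le_pow₀ (by linarith)
  set g := (b : ℝ) ^ u with hgdef
  set h := ((b : ℝ) - 2) ^ u with hhdef
  set p := (2 : ℝ) ^ u with hpdef
  set c := (b : ℝ) ^ 44 with hc
  clear_value g h p c
  have hg1 : 1 ≤ g := by nlinarith
  have hg0 : 0 < g := by linarith
  have f1 : 1 / h ^ 8 ≤ p / g ^ 8 := by
    rw [div_le_div_iff₀ (by positivity) (by positivity)]
    refine le_of_mul_le_mul_right (a := g ^ 48) ?_ (by positivity)
    calc 1 * g ^ 8 * g ^ 48 = g ^ 56 := by ring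
      _ ≤ p * h ^ 56 := hg
      _ = p * h ^ 8 * h ^ 48 := by ring
      _ ≤ p * h ^ 8 * g ^ 48 := by gcongr
  have f2 : 1 / p ≤ h ^ 48 / g ^ 48 := by
    rw [div_le_div_iff₀ (by positivity) (by positivity)]
    refine le_of_mul_le_mul_right (a := g ^ 8) ?_ (by positivity)
    calc 1 * g ^ 48 * g ^ 8 = g ^ 56 := by ring
      _ ≤ p * h ^ 56 := hg
      _ = h ^ 48 * p * h ^ 8 := by ring
      _ ≤ h ^ 48 * p * g ^ 8 := by gcongr
  have f3 : E ≤ c / g ^ 8 := by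
    refine hE.trans ?_
    gcongr
    norm_num
  refine lt_of_lt_of_le ?_ f2
  calc 16 * (g ^ 2) ^ 3 * (1 / h ^ 8 + (2 * (1 / g ^ 8) + 2 * (E + F)))
      ≤ 16 * (g ^ 2) ^ 3 * (p / g ^ 8 + (2 * (1 / g ^ 8) + 2 * (c / g ^ 8 + c / g ^ 8))) := by
        gcongr
    _ = 16 * (p + 2 + 4 * c) / g ^ 2 := by field_simp; ring
    _ ≤ 112 * p * c / g ^ 2 := by
        refine div_le_div_of_nonneg_right ?_ (by positivity)
        nlinarith [mul_nonneg (sub_nonneg.2 hp1) (sub_nonneg.2 hb44)]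
    _ < 1 / p := by
        rw [div_lt_div_iff₀ (by positivity) (by positivity)]
        calc 112 * p * c * p = p ^ 2 * (112 * c) := by ring
          _ < g * g := mul_lt_mul hgp hgb (by positivity) hg0.le
          _ = 1 * g ^ 2 := by ring

theorem scale_error_first {b G g x m : ℝ} (hb : 2048 ≤ b) (hG : 0 < G) (hg : 0 < g) (hx : 0 < x)
    (hx2 : x ^ 2 = G * b * g ^ 8) (hm : G * g ^ 48 ≤ m) :
    (21 * b ^ 2 * x) ^ 4 / (m * (x / (2 * b)) * (1 / (1344 * b ^ 5) * G / (7 * b ^ 2 * x) *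
      (1 / g ^ 8))) ≤ b ^ 21 / g ^ 24 := by
  have hm0 : 0 < m := lt_of_lt_of_le (by positivity) hm
  have hb0 : 0 < b := by linarith
  have e : (21 * b ^ 2 * x) ^ 4 / (m * (x / (2 * b)) * (1 / (1344 * b ^ 5) * G / (7 * b ^ 2 * x) *
      (1 / g ^ 8))) = 3659354496 * b ^ 18 * (G * g ^ 48) / (m * g ^ 24) := by
    have e1 : (21 * b ^ 2 * x) ^ 4 = 194481 * b ^ 8 * (G * b * g ^ 8) ^ 2 := by rw [← hx2]; ring
    rw [e1]
    field_simp
    norm_num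
  rw [e, div_le_div_iff₀ (by positivity) (by positivity)]
  have h3 : 3659354496 ≤ b ^ 3 := by
    calc (3659354496 : ℝ) ≤ 2048 ^ 3 := by norm_num
      _ ≤ b ^ 3 := by gcongr
  calc 3659354496 * b ^ 18 * (G * g ^ 48) * g ^ 24
      ≤ b ^ 3 * b ^ 18 * m * g ^ 24 := by gcongr
    _ = b ^ 21 * (m * g ^ 24) := by ring

theorem scale_error_second {b G g x m : ℝ} (hb : 2048 ≤ b) (hG : 0 < G) (hg : 0 < g) (hx : 0 < x)
    (hx2 : x ^ 2 = G * b * g ^ 8) (hm : G * g ^ 48 ≤ m) :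
    (21 * b ^ 2 * x) ^ 8 / (m * (x / (2 * b)) ^ 4 * (1 / (1344 * b ^ 5) * G / (7 * b ^ 2 * x) *
      (1 / g ^ 8)) ^ 2) ≤ b ^ 44 / g ^ 8 := by
  have hm0 : 0 < m := lt_of_lt_of_le (by positivity) hm
  have hb0 : 0 < b := by linarith
  have e : (21 * b ^ 2 * x) ^ 8 / (m * (x / (2 * b)) ^ 4 * (1 / (1344 * b ^ 5) * G /
      (7 * b ^ 2 * x) * (1 / g ^ 8)) ^ 2) =
      53563501309581656064 * b ^ 37 * (G * g ^ 48) / (m * g ^ 8) := by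
    have e1 : (21 * b ^ 2 * x) ^ 8 = 37822859361 * b ^ 16 * x ^ 2 * (G * b * g ^ 8) ^ 3 := by
      rw [← hx2]; ring
    rw [e1]
    field_simp
    norm_num
  rw [e, div_le_div_iff₀ (by positivity) (by positivity)]
  have h3 : 53563501309581656064 ≤ b ^ 7 := by
    calc (53563501309581656064 : ℝ) ≤ 2048 ^ 7 := by norm_num
      _ ≤ b ^ 7 := by gcongr
  calc 53563501309581656064 * b ^ 37 * (G * g ^ 48) * g ^ 8
      ≤ b ^ 7 * b ^ 37 * m * g ^ 8 := by gcongr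
    _ = b ^ 44 * (m * g ^ 8) := by ring

/-- A badly approximable point of an admissible node has an admissible node at a finer scale
next to it. -/
theorem exists_adm_near {b k K : ℕ} (hb : 2048 ≤ b) (hk : k ≤ K) {a : ℤ} (ha : Adm b k a) {β : ℝ}
    (hβ1 : (a : ℝ) ≤ β * b ^ k) (hβ2 : β * (b : ℝ) ^ k < a + 1)
    (hβ : BadOn (1 / (336 * b ^ 4)) (b ^ k / (3 * b)) (b ^ K / (672 * b ^ 4)) β) :
    ∃ a' : ℤ, a' / (b : ℤ) ^ (K + 1 - k) = a ∧ Adm b (K + 1) a' ∧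
      ∀ β' ∈ Node b (K + 1) a', |β' - β| * (b : ℝ) ^ K ≤ 1 := by
  classical
  have hb0 : (2048 : ℝ) ≤ b := by exact_mod_cast hb
  have hbp : (0 : ℝ) < b := by linarith
  have hbn : 0 < b := by omega
  have hKpos : (0 : ℝ) < (b : ℝ) ^ K := by positivity
  set a₁ : ℤ := ⌊β * (b : ℝ) ^ K⌋ with ha₁
  have hmem : β ∈ Node b K a₁ :=
    (mem_node_iff hbn).2 ⟨Int.floor_le _, (Int.lt_floor_add_one _).le⟩
  obtain ⟨j, rfl⟩ := Nat.exists_eq_add_of_le hk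
  have hdiv : a₁ / (b : ℤ) ^ j = a := by
    have hj : (0 : ℤ) < (b : ℤ) ^ j := by positivity
    have hjr : (0 : ℝ) < (b : ℝ) ^ j := by positivity
    have h1 : a * (b : ℤ) ^ j ≤ a₁ := by
      rw [ha₁, Int.le_floor]
      push_cast
      rw [pow_add, ← mul_assoc]
      gcongr
    have h2 : a₁ < (a + 1) * (b : ℤ) ^ j := by
      rw [ha₁, Int.floor_lt]
      push_cast
      rw [pow_add, ← mul_assoc]
      gcongr
    refine le_antisymm ?_ ?_
    · exact Int.lt_add_one_iff.1 ((Int.ediv_lt_iff_lt_mul hj).2 h2)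
    · exact (Int.le_ediv_iff_mul_le hj).2 h1
  have hsub := node_sub_of_ediv (k := k) hbn hdiv
  obtain ⟨i, hi⟩ : ((Finset.range b).filter fun i : ℕ => ∀ x ∈ Node b (k + j + 1) (b * a₁ + i),
      BadOn (1 / (1344 * b ^ 5)) (1 / (672 * (b : ℝ) ^ 4) * b ^ (k + j))
        (b ^ (k + j) / 3) x).Nonempty := by
    have := free_children (b := b) (k := k + j) (F := 1 / (672 * (b : ℝ) ^ 4))
      (c := 1 / (1344 * b ^ 5)) (by omega) (by positivity)
      (le_of_eq (by field_simp; norm_num)) a₁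
    rw [← Finset.card_pos]
    refine lt_of_lt_of_le (by omega : 0 < b - 2) (this.trans (le_of_eq (by congr)))
  rw [Finset.mem_filter] at hi
  have hib := Finset.mem_range.1 hi.1
  have hsub1 : Node b (k + j + 1) (b * a₁ + i) ⊆ Node b (k + j) a₁ :=
    node_sub_of_ediv hbn (by rw [pow_one, child_ediv hib])
  refine ⟨b * a₁ + i, ?_, ?_, fun β' hβ' => node_abs_sub_le hbn (hsub1 hβ') hmem⟩
  · rw [show k + j + 1 - k = j + 1 by omega]
    exact child_ediv_pow hib hdiv
  · intro z hz
    have hz1 := hsub1 hz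
    have hz2 := hsub hz1
    have hclose := node_abs_sub_le hbn hz1 hmem
    have hmid : BadOn (1 / (1344 * (b : ℝ) ^ 5)) (b ^ k / (3 * b))
        (1 / (672 * (b : ℝ) ^ 4) * b ^ (k + j)) z := by
      intro q hq hlo hhi p
      have hqr : (0 : ℝ) < q := by exact_mod_cast hq
      have h1 := hβ q hq hlo (hhi.trans_le (le_of_eq (by ring))) p
      have h2 : |(q : ℝ) * β - p| ≤ |q * z - p| + q * |z - β| := by
        have e : (q : ℝ) * β - p = (q * z - p) + -(q * (z - β)) := by ring
        rw [e]
        refine (abs_add_le _ _).trans ?_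
        rw [abs_neg, abs_mul (q : ℝ), abs_of_pos hqr]
      have h3 : (q : ℝ) ^ 2 * |z - β| ≤ 1 / (672 * (b : ℝ) ^ 4) := by
        calc (q : ℝ) ^ 2 * |z - β| ≤ 1 / (672 * (b : ℝ) ^ 4) * b ^ (k + j) * |z - β| := by gcongr
          _ = 1 / (672 * (b : ℝ) ^ 4) * (|z - β| * b ^ (k + j)) := by ring
          _ ≤ 1 / (672 * (b : ℝ) ^ 4) * 1 := by gcongr
          _ = _ := mul_one _
      have h4 := mul_le_mul_of_nonneg_left h2 hqr.le
      have h5 : 1 / (1344 * (b : ℝ) ^ 5) ≤ 1 / (672 * (b : ℝ) ^ 4) := by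
        gcongr 1 / ?_
        have : 0 < (b : ℝ) ^ 4 := by positivity
        nlinarith
      have h6 : 1 / (336 * (b : ℝ) ^ 4) = 2 * (1 / (672 * (b : ℝ) ^ 4)) := by field_simp; norm_num
      linarith
    refine ((ha z hz2).union hmid).union ((hi.2 z hz).mono le_rfl le_rfl (le_of_eq ?_))
    rw [pow_succ]; field_simp

/-- Every node has an interior child free of fractions of the next size. -/
theorem exists_interior_child {b : ℕ} (hb : 5 ≤ b) (k : ℕ) (a : ℤ) :
    ∃ i : ℕ, 1 ≤ i ∧ i + 2 ≤ b ∧ ∀ x ∈ Node b (k + 1) (b * a + i),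
      BadOn (1 / (6 * b ^ 2)) (b ^ k / (3 * b)) (b ^ (k + 1) / (3 * b)) x := by
  classical
  have h := free_children (b := b) (k := k) (F := 1 / (3 * b)) (c := 1 / (6 * b ^ 2)) (by omega)
      (by positivity) (le_of_eq (by field_simp; norm_num)) a
  set S := (Finset.range b).filter fun i : ℕ => ∀ x ∈ Node b (k + 1) (b * a + i),
    BadOn (1 / (6 * b ^ 2)) (1 / (3 * b) * b ^ k) (b ^ k / 3) x with hS
  have hcard : 1 ≤ (S \ {0, b - 1}).card := by
    have h1 := Finset.le_card_sdiff ({0, b - 1} : Finset ℕ) S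
    have h2 : ({0, b - 1} : Finset ℕ).card ≤ 2 := Finset.card_le_two
    have h3 : b - 2 ≤ S.card := h.trans (le_of_eq (by rw [hS]))
    omega
  obtain ⟨i, hi⟩ := Finset.card_pos.1 hcard
  simp only [Finset.mem_sdiff, Finset.mem_insert, Finset.mem_singleton, not_or, hS,
    Finset.mem_filter, Finset.mem_range] at hi
  refine ⟨i, by omega, by omega, fun x hx => (hi.1.2 x hx).mono le_rfl ?_ ?_⟩
  · exact le_of_eq (by ring)
  · exact le_of_eq (by rw [pow_succ]; field_simp)

theorem mem_parent_of_near {b k : ℕ} (hb : 0 < b) {a : ℤ} {i : ℕ} (hi1 : 1 ≤ i) (hi2 : i + 2 ≤ b)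
    {x z : ℝ} (hx : x ∈ Node b (k + 1) (b * a + i)) (hz : |x - z| * (b : ℝ) ^ (k + 1) < 1) :
    (a : ℝ) ≤ z * b ^ k ∧ z * (b : ℝ) ^ k < a + 1 := by
  have hpos : (0 : ℝ) < (b : ℝ) ^ (k + 1) := by positivity
  have hb0 : (0 : ℝ) < b := by exact_mod_cast hb
  rw [mem_node_iff hb] at hx
  rw [← abs_of_pos hpos, ← abs_mul, abs_lt, sub_mul] at hz
  have h1 : (1 : ℝ) ≤ i := by exact_mod_cast hi1
  have h2 : (i : ℝ) + 2 ≤ b := by exact_mod_cast hi2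
  have e : z * (b : ℝ) ^ (k + 1) = z * b ^ k * b := by ring
  push_cast at hx
  rw [e] at hz
  constructor
  · refine le_of_mul_le_mul_right ?_ hb0
    linarith [hx.1, hz.2]
  · refine lt_of_mul_lt_mul_right ?_ hb0.le
    linarith [hx.2, hz.1]

theorem exists_root_cells {b : ℕ} (hb : 3 ≤ b) (L : ℕ) :
    ∃ T : Finset ℕ, T ⊆ Finset.range (b ^ L) ∧ T.card = (b - 2) ^ L ∧
      ∀ r ∈ T, ∀ y ∈ Icc ((r : ℝ) / (b ^ L : ℕ)) ((r + 1) / (b ^ L : ℕ)),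
        BadOn (1 / (6 * b ^ 2)) 0 (b ^ L / (3 * b)) y := by
  obtain ⟨A, hA1, hA2⟩ := exists_descendants hb 0 L 0
  have hb0 : (3 : ℝ) ≤ b := by exact_mod_cast hb
  have hpos : (0 : ℤ) < (b : ℤ) ^ L := by positivity
  have hA0 : ∀ r < (b - 2) ^ L, 0 ≤ A r ∧ A r < (b : ℤ) ^ L := by
    intro r hr
    have h := (hA2 r hr).1
    have h1 := Int.emod_add_mul_ediv (A r) ((b : ℤ) ^ L)
    rw [h, mul_zero, add_zero] at h1
    exact ⟨h1 ▸ Int.emod_nonneg _ hpos.ne', h1 ▸ Int.emod_lt_of_pos _ hpos⟩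
  refine ⟨(Finset.range ((b - 2) ^ L)).image fun r => (A r).toNat, ?_, ?_, ?_⟩
  · intro r hr
    obtain ⟨s, hs, rfl⟩ := Finset.mem_image.1 hr
    obtain ⟨h1, h2⟩ := hA0 s (Finset.mem_range.1 hs)
    rw [Finset.mem_range]
    zify
    rwa [Int.toNat_of_nonneg h1]
  · rw [Finset.card_image_of_injOn, Finset.card_range]
    intro r hr s hs hrs
    have hr' := Finset.mem_range.1 hr
    have hs' := Finset.mem_range.1 hs
    have h1 := hA0 r hr'
    have h2 := hA0 s hs'
    have h3 : A r = A s := by simp only at hrs; omega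
    rcases lt_trichotomy r s with h | h | h
    · exact absurd h3 (hA1 _ _ h hs').ne
    · exact h
    · exact absurd h3 (hA1 _ _ h hr').ne'
  · intro r hr y hy
    obtain ⟨s, hs, rfl⟩ := Finset.mem_image.1 hr
    have hs' := Finset.mem_range.1 hs
    have hy' : y ∈ Node b (0 + L) (A s) := by
      rw [zero_add, Node]
      have : ((A s).toNat : ℝ) = (A s : ℝ) := by
        exact_mod_cast Int.toNat_of_nonneg (hA0 s hs').1
      rw [this] at hy
      push_cast at hy
      exact hy
    have h := (hA2 s hs').2 y hy'
    rw [zero_add] at h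
    intro q hq _ h2 p
    refine h q hq ?_ h2 p
    have hq1 : (1 : ℝ) ≤ q := by exact_mod_cast hq
    rw [pow_zero, div_le_iff₀ (by positivity)]
    nlinarith [one_le_pow₀ hq1 (n := 2)]

set_option maxHeartbeats 1000000 in
/-- Inside an admissible node there is a controlled point whose dilation by `m` is close to the
target `t` modulo one. -/
theorem exists_hit_point {b u k : ℕ} (hb : 2048 ≤ b) (hu : 50 ≤ u) (hk : 9 * u ≤ k) {a : ℤ}
    (ha : Adm b k a) {m : ℝ} (hm1 : (b : ℝ) ^ (k + 48 * u) ≤ m)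
    (hm2 : m ≤ (b : ℝ) ^ (k + 48 * u + 1)) (t : ℝ) :
    ∃ β : ℝ, (a : ℝ) ≤ β * b ^ k ∧ β * (b : ℝ) ^ k < a + 1 ∧
      BadOn (1 / (336 * b ^ 4)) (b ^ k / (3 * b)) (b ^ (k + 49 * u + 1) / (672 * b ^ 4)) β ∧
      ∃ j : ℤ, |m * β - t - j| < 1 / (b : ℝ) ^ u := by
  have hb0 : (2048 : ℝ) ≤ b := by exact_mod_cast hb
  have hb1 : (1 : ℝ) ≤ b := by linarith
  have hbp : (0 : ℝ) < b := by linarith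
  have hbn : 0 < b := by omega
  set G : ℝ := (b : ℝ) ^ k with hG
  set g : ℝ := (b : ℝ) ^ u with hg
  have hGpos : 0 < G := by positivity
  have hgpos : 0 < g := by positivity
  set κ := k + 1 + 8 * u with hκ
  have hκG : (b : ℝ) ^ κ = G * b * g ^ 8 := by rw [hκ, hG, hg]; ring
  set x : ℝ := √((b : ℝ) ^ κ) with hxdef
  have hx2 : x ^ 2 = (b : ℝ) ^ κ := by rw [hxdef, Real.sq_sqrt (by positivity)]
  have hx2' : x ^ 2 = G * b * g ^ 8 := hx2.trans hκG
  have hxpos : 0 < x := Real.sqrt_pos.2 (by positivity)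
  have hx1 : 1 ≤ x := by
    rw [hxdef, Real.one_le_sqrt]; exact one_le_pow₀ hb1
  have hm1' : G * g ^ 48 ≤ m := le_trans (le_of_eq (by rw [hG, hg]; ring)) hm1
  have hm2' : m ≤ G * g ^ 48 * b := hm2.trans (le_of_eq (by rw [hG, hg]; ring))
  have hmpos : 0 < m := lt_of_lt_of_le (by positivity) hm1'
  have hg1 : 1 ≤ g := one_le_pow₀ hb1
  have hgb : ∀ n ≤ 50, (b : ℝ) ^ n ≤ g := fun n hn => pow_le_pow_right₀ hb1 (by omega)
  have hGg : g ^ 9 ≤ G := by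
    rw [hG, hg, ← pow_mul]; exact pow_le_pow_right₀ hb1 (by omega)
  obtain ⟨i, hi1, hi2, hchild⟩ := exists_interior_child (by omega : 5 ≤ b) k a
  obtain ⟨A, hA1, hA2⟩ := exists_descendants (by omega : 3 ≤ b) (k + 1) (8 * u) (b * a + i)
  have hcen : ∀ r : ℕ, ((A r : ℝ) + 1 / 2) / (b : ℝ) ^ κ ∈ Node b κ (A r) := by
    intro r
    rw [mem_node_iff hbn, div_mul_cancel₀ _ (by positivity)]
    constructor <;> linarith
  set x₀ : ℕ → ℝ := fun r => ((A r : ℝ) + 1 / 2) / (b : ℝ) ^ κ with hx₀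
  have hx₀child : ∀ r < (b - 2) ^ (8 * u), x₀ r ∈ Node b (k + 1) (b * a + i) := fun r hr =>
    node_sub_of_ediv hbn (hA2 r hr).1 (hcen r)
  have hx₀bad : ∀ r < (b - 2) ^ (8 * u),
      BadOn (1 / (6 * b ^ 2)) (G / (3 * b)) (x ^ 2 / (3 * b)) (x₀ r) := by
    intro r hr
    rw [hx2]
    exact (hchild _ (hx₀child r hr)).union ((hA2 r hr).2 _ (hcen r))
  have hx₀par : ∀ r < (b - 2) ^ (8 * u), ∀ z, |x₀ r - z| * x ^ 2 ≤ 5 * b ^ 2 →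
      (a : ℝ) ≤ z * G ∧ z * G < a + 1 := by
    intro r hr z hz
    refine mem_parent_of_near hbn hi1 hi2 (hx₀child r hr) ?_
    rw [hx2'] at hz
    have e : (b : ℝ) ^ (k + 1) = G * b := by rw [hG]; ring
    rw [e]
    refine lt_of_mul_lt_mul_right (a := g ^ 8) ?_ (by positivity)
    have h1 : 5 * (b : ℝ) ^ 2 < g ^ 8 := by
      calc 5 * (b : ℝ) ^ 2 < b * b ^ 2 := by gcongr; linarith
        _ = (b : ℝ) ^ 3 := by ring
        _ ≤ g := hgb 3 (by norm_num)
        _ ≤ g ^ 8 := le_self_pow₀ hg1 (by norm_num)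
    linarith
  have hx₀node : ∀ r < (b - 2) ^ (8 * u), ∀ z, |x₀ r - z| * x ^ 2 ≤ 5 * b ^ 2 →
      z ∈ Node b k a := fun r hr z hz =>
    (mem_node_iff hbn).2 ⟨(hx₀par r hr z hz).1, (hx₀par r hr z hz).2.le⟩
  have hcx : G / (3 * b) ≤ (1 / (1344 * (b : ℝ) ^ 5) * x) ^ 2 := by
    rw [mul_pow, hx2', div_pow, one_pow, div_mul_eq_mul_div, one_mul,
      div_le_div_iff₀ (by positivity) (by positivity)]
    have h1 : 1344 ^ 2 * (b : ℝ) ^ 10 ≤ g := by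
      calc 1344 ^ 2 * (b : ℝ) ^ 10 ≤ b ^ 2 * (b : ℝ) ^ 10 := by gcongr; linarith
        _ = (b : ℝ) ^ 12 := by ring
        _ ≤ g := hgb 12 (by norm_num)
    have h2 : g ≤ g ^ 8 := le_self_pow₀ hg1 (by norm_num)
    calc G * (1344 * (b : ℝ) ^ 5) ^ 2 = G * (1344 ^ 2 * (b : ℝ) ^ 10) := by ring
      _ ≤ G * g ^ 8 := by gcongr; exact h1.trans h2
      _ ≤ G * g ^ 8 * (b * (3 * b)) := le_mul_of_one_le_right (by positivity) (by nlinarith)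
      _ = G * b * g ^ 8 * (3 * b) := by ring
  have hfrac : ∀ r, ∃ (P : ℤ) (Q : ℕ) (P' Q' : ℤ), r < (b - 2) ^ (8 * u) →
      0 < Q ∧ x ≤ 2 * b * Q ∧ (Q : ℝ) ≤ 7 * b ^ 2 * x ∧ |x₀ r - P / Q| * x ^ 2 ≤ 1 / 4 ∧
      P * Q' - P' * Q = 1 ∧ (Q : ℤ) ≤ Q' ∧ Q' ≤ 2 * Q := by
    intro r
    by_cases hr : r < (b - 2) ^ (8 * u)
    · obtain ⟨P, Q, h1, h2, h3, h4, h5⟩ := exists_frac (by omega : 2 ≤ b) hx1 (hx₀bad r hr)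
        (ha _ (hx₀node r hr _ (by rw [sub_self, abs_zero, zero_mul]; positivity))) hcx
        (by positivity)
      obtain ⟨P', Q', h6, h7, h8⟩ := exists_bezout h1 h2
      exact ⟨P, Q, P', Q', fun _ => ⟨h1, h3, h4, h5, h6, h7, h8⟩⟩
    · exact ⟨0, 0, 0, 0, fun h => absurd h hr⟩
  choose P Q P' Q' hF using hfrac
  set W := Finset.range ((b - 2) ^ (8 * u)) with hW
  have hWne : W.Nonempty := by
    rw [hW, Finset.nonempty_range_iff]
    exact pow_ne_zero _ (by omega)
  have hWm : ∀ r, r ∈ W ↔ r < (b - 2) ^ (8 * u) := fun r => Finset.mem_range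
  set ξ : ℕ → ℝ := fun r => P r / Q r with hξ
  have hb2 : (1 : ℝ) ≤ b ^ 2 := one_le_pow₀ hb1
  have hξnode : ∀ r < (b - 2) ^ (8 * u), ξ r ∈ Node b k a := fun r hr =>
    hx₀node r hr _ ((hF r hr).2.2.2.1.trans (by linarith))
  have hξne : ∀ r < (b - 2) ^ (8 * u), ∀ s < (b - 2) ^ (8 * u), r ≠ s → ξ r ≠ ξ s := by
    intro r hr s hs hrs heq
    have h1 := (hF r hr).2.2.2.1
    have h2 := (hF s hs).2.2.2.1
    have hA : A r ≠ A s := by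
      rcases lt_or_gt_of_ne hrs with h | h
      · exact (hA1 _ _ h hs).ne
      · exact (hA1 _ _ h hr).ne'
    change |x₀ r - ξ r| * x ^ 2 ≤ 1 / 4 at h1
    change |x₀ s - ξ s| * x ^ 2 ≤ 1 / 4 at h2
    rw [← heq, abs_sub_comm] at h2
    have h3 : |x₀ r - x₀ s| * x ^ 2 ≤ 1 / 2 := by
      have := abs_sub_le (x₀ r) (ξ r) (x₀ s)
      have := mul_le_mul_of_nonneg_right this (sq_nonneg x)
      linarith
    have h4 : x₀ r - x₀ s = ((A r - A s : ℤ) : ℝ) / x ^ 2 := by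
      rw [hx₀, hx2]; push_cast; ring
    rw [h4, abs_div, abs_of_pos (by positivity : 0 < x ^ 2),
      div_mul_cancel₀ _ (by positivity)] at h3
    have h5 : (1 : ℝ) ≤ |((A r - A s : ℤ) : ℝ)| := by
      rw [← Int.cast_abs]
      exact_mod_cast Int.one_le_abs (sub_ne_zero.2 hA)
    linarith
  have hxG : 7 * (b : ℝ) ^ 2 * x < G := by
    refine lt_of_pow_lt_pow_left₀ 2 hGpos.le ?_
    calc (7 * (b : ℝ) ^ 2 * x) ^ 2 = 49 * b ^ 5 * (G * g ^ 8) := by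
          rw [mul_pow, hx2']; ring
      _ < b * b ^ 5 * (G * g ^ 8) := by gcongr; linarith
      _ = b ^ 6 * (G * g ^ 8) := by ring
      _ ≤ g * (G * g ^ 8) := by gcongr; exact hgb 6 (by norm_num)
      _ = G * g ^ 9 := by ring
      _ ≤ G * G := by gcongr
      _ = G ^ 2 := by ring
  set D : ℝ := 1 / (1344 * (b : ℝ) ^ 5) * G / (7 * b ^ 2 * x) with hD
  have hDlo : D ^ 2 ≤ G / (3 * b) := by
    have e : D ^ 2 = G / (1344 ^ 2 * b ^ 10 * 49 * b ^ 4 * (b * g ^ 8)) := by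
      rw [hD, div_pow, mul_pow (7 * (b : ℝ) ^ 2), hx2']; field_simp; norm_num
    rw [e]
    gcongr G / ?_
    have h1 : (1 : ℝ) ≤ b ^ 10 := one_le_pow₀ hb1
    have h2 : (1 : ℝ) ≤ b ^ 4 := one_le_pow₀ hb1
    have h3 : (1 : ℝ) ≤ g ^ 8 := one_le_pow₀ hg1
    calc (3 : ℝ) * b ≤ 1344 ^ 2 * 1 * 49 * 1 * (b * 1) := by linarith
      _ ≤ 1344 ^ 2 * b ^ 10 * 49 * b ^ 4 * (b * g ^ 8) := by gcongr
  have hsep : ∀ r ∈ W, ∀ s ∈ W, r ≠ s → D ≤ |(Q r : ℝ) - Q s| := by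
    intro r hr s hs hrs
    rw [hWm] at hr hs
    exact den_separation (hF r hr).1 (hF s hs).1 rfl rfl (hξne r hr s hs hrs)
      (ha _ (hξnode s hs)) hGpos (node_abs_sub_le hbn (hξnode r hr) (hξnode s hs))
      (hF r hr).2.2.1 hxG hDlo
  obtain ⟨T, hT1, hT2, hT3⟩ := exists_root_cells (by omega : 3 ≤ b) (48 * u)
  have hE := scale_error_first hb0 hGpos hgpos hxpos hx2' hm1'
  have hE' := scale_error_second hb0 hGpos hgpos hxpos hx2' hm1'
  have hscale := scale_inequality hb hu hE hE'
  have hg8 : (b : ℝ) ^ (8 * u) = g ^ 8 := by rw [hg]; ring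
  have hDpos : 0 < D := by positivity
  have hQ'r : ∀ r < (b - 2) ^ (8 * u), (Q r : ℝ) ≤ Q' r ∧ (Q' r : ℝ) ≤ 2 * Q r := by
    intro r hr
    obtain ⟨-, -, -, -, -, h1, h2⟩ := hF r hr
    exact ⟨by exact_mod_cast h1, by exact_mod_cast h2⟩
  have hXQ : ∀ r ∈ W, x / (2 * b) ≤ (Q r : ℝ) := by
    intro r hr
    rw [div_le_iff₀ (by positivity)]
    linarith [(hF r ((hWm r).1 hr)).2.1]
  have hQY : ∀ r ∈ W, (Q r : ℝ) + Q' r ≤ 21 * b ^ 2 * x := by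
    intro r hr
    rw [hWm] at hr
    linarith [(hQ'r r hr).2, (hF r hr).2.2.1]
  have hTc : 16 * ((b ^ (2 * u) : ℕ) : ℝ) ^ 3 * (1 / (W.card : ℝ) + (2 * (1 / g ^ 8) +
      2 * ((21 * b ^ 2 * x) ^ 4 / (m * (x / (2 * b)) * (D * (1 / g ^ 8))) +
        (21 * b ^ 2 * x) ^ 8 / (m * (x / (2 * b)) ^ 4 * (D * (1 / g ^ 8)) ^ 2)))) <
      (T.card : ℝ) / (b ^ (48 * u) : ℕ) := by
    rw [hT2, hW, Finset.card_range]
    rw [hg8] at hscale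
    push_cast
    exact hscale
  have hlip : 8 * π * ((b ^ (2 * u) : ℕ) : ℝ) ^ 2 * m ≤
      (x / (2 * b)) ^ 2 * (b ^ (48 * u) : ℕ) := by
    have e1 : ((b ^ (2 * u) : ℕ) : ℝ) = g ^ 2 := by rw [hg]; push_cast; ring
    have e2 : ((b ^ (48 * u) : ℕ) : ℝ) = g ^ 48 := by rw [hg]; push_cast; ring
    rw [e1, e2, div_pow, hx2', div_mul_eq_mul_div, le_div_iff₀ (by positivity)]
    have hpi : 32 * π ≤ b := by linarith [pi_lt_four]
    calc 8 * π * (g ^ 2) ^ 2 * m * (2 * b) ^ 2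
        ≤ 8 * π * (g ^ 2) ^ 2 * (G * g ^ 48 * b) * (2 * b) ^ 2 := by gcongr
      _ = 32 * π * (b ^ 3 * G * g ^ 52) := by ring
      _ ≤ b * (b ^ 3 * G * g ^ 52) := by gcongr
      _ = b ^ 3 * (b * G * g ^ 52) := by ring
      _ ≤ g * (b * G * g ^ 52) := by gcongr; exact hgb 3 (by norm_num)
      _ = b * G * g ^ 53 := by ring
      _ ≤ b * G * g ^ 56 := by gcongr; norm_num
      _ = G * b * g ^ 8 * g ^ 48 := by ring
  obtain ⟨r₀, hr₀, y, hy, hsum⟩ := exists_small_expsums W hWne (ξ := ξ) (Q := fun r => (Q r : ℝ))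
    (Q' := fun r => (Q' r : ℝ)) (X := x / (2 * b)) (Y := 21 * b ^ 2 * x) (D := D)
    (w := 1 / g ^ 8) (m := m) (by positivity) hXQ
    (fun r hr => (hQ'r r ((hWm r).1 hr)).1) hQY hmpos hDpos (by positivity) hsep
    (H := b ^ (2 * u)) (n := b ^ (48 * u)) (by positivity) (by positivity) hT1 hTc hlip
  have hybad := hT3 r₀ hr₀ y hy
  have hr₀lt := Finset.mem_range.1 (hT1 hr₀)
  have hnpos : (0 : ℝ) < ((b ^ (48 * u) : ℕ) : ℝ) := by positivity
  have hy0 : 0 ≤ y := le_trans (by positivity) hy.1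
  have hy1 : y ≤ 1 := by
    refine hy.2.trans ?_
    rw [div_le_one hnpos]
    exact_mod_cast hr₀lt
  have hnr : 1 ≤ ((b ^ (2 * u) : ℕ) : ℝ) * (1 / (b : ℝ) ^ u) ^ 2 := by
    refine le_of_eq ?_
    push_cast
    rw [div_pow, one_pow, ← pow_mul, mul_comm u 2]
    field_simp
  obtain ⟨r, hr, j, hj⟩ := exists_close_of_norm_sum_ex_le W hWne
    (fun r => m * mob (ξ r) (Q r) (Q' r) y) (r := 1 / (b : ℝ) ^ u) (n := b ^ (2 * u))
    (by positivity) hnr (fun h h1 h2 => hsum h h1 h2) t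
  rw [hWm] at hr
  obtain ⟨h1, h2, h3, h4, h5, h6, h7⟩ := hF r hr
  have hdist := abs_sub_mob_le (by omega : 2 ≤ b) hxpos (by exact_mod_cast h1)
    (hQ'r r hr).1 h2 h4 hy0
  obtain ⟨hp1, hp2⟩ := hx₀par r hr _ hdist
  refine ⟨mob (ξ r) (Q r) (Q' r) y, hp1, hp2, ?_, j, hj⟩
  refine (badOn_mob (by omega : 2 ≤ b) hxpos h1 rfl h5 h6 h7 h2 h3 h4 hy0 hy1 hybad
    (hx₀bad r hr)).mono le_rfl le_rfl ?_
  have e1 : (b : ℝ) ^ (k + 49 * u + 1) = G * g ^ 49 * b := by rw [hG, hg]; ring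
  have e2 : (b : ℝ) ^ (48 * u) = g ^ 48 := by rw [hg]; ring
  rw [e1, e2, hx2', mul_div_assoc', div_div, div_le_div_iff₀ (by positivity) (by positivity)]
  have hb4 : (1 : ℝ) ≤ b ^ 4 := one_le_pow₀ hb1
  calc G * g ^ 49 * b * (3 * b * (16 * b ^ 2)) = 48 * b ^ 3 * (G * g ^ 49 * b) := by ring
    _ ≤ b * b ^ 3 * (G * g ^ 49 * b) := by gcongr; linarith
    _ = b ^ 4 * (G * g ^ 49 * b) := by ring
    _ ≤ g * (G * g ^ 49 * b) := by gcongr; exact hgb 4 (by norm_num)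
    _ = G * b * g ^ 50 := by ring
    _ ≤ G * b * g ^ 56 := by gcongr; norm_num
    _ = G * b * g ^ 8 * g ^ 48 * 1 := by ring
    _ ≤ G * b * g ^ 8 * g ^ 48 * (672 * b ^ 4) := by gcongr; linarith

/-- Every admissible node has an admissible descendant on which the dilation by `m` hits the
target `t` modulo one. -/
theorem exists_hit {b u k : ℕ} (hb : 2048 ≤ b) (hu : 50 ≤ u) (hk : 9 * u ≤ k) {a : ℤ}
    (ha : Adm b k a) {m : ℝ} (hm1 : (b : ℝ) ^ (k + 48 * u) ≤ m)
    (hm2 : m ≤ (b : ℝ) ^ (k + 48 * u + 1)) (t : ℝ) :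
    ∃ a' : ℤ, a' / (b : ℤ) ^ (49 * u + 2) = a ∧ Adm b (k + (49 * u + 2)) a' ∧
      ∀ β ∈ Node b (k + (49 * u + 2)) a', ∃ j : ℤ, |m * β - t - j| ≤ 2 / (b : ℝ) ^ u := by
  have hb0 : (2048 : ℝ) ≤ b := by exact_mod_cast hb
  have hbp : (0 : ℝ) < b := by linarith
  obtain ⟨β, h1, h2, h3, j, hj⟩ := exists_hit_point hb hu hk ha hm1 hm2 t
  obtain ⟨a', h4, h5, h6⟩ := exists_adm_near hb (by omega : k ≤ k + 49 * u + 1) ha h1 h2 h3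
  refine ⟨a', ?_, ?_, ?_⟩
  · rw [← h4]; congr 2; omega
  · rw [show k + (49 * u + 2) = k + 49 * u + 1 + 1 by ring]; exact h5
  · rw [show k + (49 * u + 2) = k + 49 * u + 1 + 1 by ring]
    intro β' hβ'
    refine ⟨j, ?_⟩
    have h7 := h6 β' hβ'
    have hm0 : 0 < m := lt_of_lt_of_le (by positivity) hm1
    have h8 : m * |β' - β| ≤ 1 / (b : ℝ) ^ u := by
      rw [le_div_iff₀ (by positivity)]
      calc m * |β' - β| * (b : ℝ) ^ u
          ≤ (b : ℝ) ^ (k + 48 * u + 1) * |β' - β| * (b : ℝ) ^ u := by gcongr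
        _ = |β' - β| * (b : ℝ) ^ (k + 49 * u + 1) := by ring
        _ ≤ 1 := h7
    have e : m * β' - t - j = (m * β - t - j) + m * (β' - β) := by ring
    rw [e]
    refine (abs_add_le _ _).trans ?_
    rw [abs_mul m, abs_of_pos hm0, show (2 : ℝ) / (b : ℝ) ^ u = 1 / (b : ℝ) ^ u + 1 / (b : ℝ) ^ u by ring]
    exact add_le_add hj.le h8

theorem nint_le (x : ℝ) (j : ℤ) : nint x ≤ |x - j| :=
  ciInf_le ⟨0, by rintro _ ⟨n, rfl⟩; exact abs_nonneg _⟩ j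

theorem nint_nonneg (x : ℝ) : 0 ≤ nint x := le_ciInf fun _ => abs_nonneg _

/-- Convergents of an irrational number as reduced fractions. -/
theorem exists_convergents {α : ℝ} (hα : Irrational α) :
    ∃ (P : ℕ → ℤ) (Q : ℕ → ℕ), ∀ n, (Q n : ℝ) = contDen α n ∧ 0 < Q n ∧
      IsCoprime (P n) (Q n : ℤ) ∧ |α - P n / Q n| * (Q n : ℝ) ^ 2 ≤ 1 ∧ 2 * Q n ≤ Q (n + 2) := by
  have hterm : ∀ n, ¬ (GenContFract.of α).TerminatedAt n := by
    intro n hn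
    have h : (GenContFract.of α).Terminates := ⟨n, hn⟩
    obtain ⟨q, hq⟩ := (GenContFract.terminates_iff_rat α).1 h
    exact hα ⟨q, hq.symm⟩
  have hs : ∀ n, ∃ z : ℤ, 1 ≤ z ∧ (GenContFract.of α).s.get? n = some ⟨1, z⟩ := by
    intro n
    obtain ⟨gp, hgp⟩ := Option.ne_none_iff_exists'.1 (hterm n)
    obtain ⟨h1, z, hz⟩ := GenContFract.of_partNum_eq_one_and_exists_int_partDen_eq hgp
    have h2 := GenContFract.of_one_le_get?_partDen (GenContFract.partDen_eq_s_b hgp)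
    refine ⟨z, ?_, ?_⟩
    · rw [hz] at h2; exact_mod_cast h2
    · rw [hgp, ← h1, ← hz]
  have hnum : ∀ n, (∃ p : ℤ, (GenContFract.of α).nums n = p) ∧
      ∃ p : ℤ, (GenContFract.of α).nums (n + 1) = p := by
    intro n
    induction n with
    | zero =>
      obtain ⟨z, -, hz⟩ := hs 0
      refine ⟨⟨⌊α⌋, by simp⟩, ⟨z * ⌊α⌋ + 1, ?_⟩⟩
      rw [zero_add, GenContFract.first_num_eq hz]
      simp
    | succ n ih =>
      obtain ⟨⟨p, hp⟩, ⟨p', hp'⟩⟩ := ih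
      obtain ⟨z, -, hz⟩ := hs (n + 1)
      refine ⟨⟨p', hp'⟩, ⟨z * p' + p, ?_⟩⟩
      rw [GenContFract.nums_recurrence hz hp hp']
      push_cast; ring
  have hden : ∀ n, (∃ p : ℕ, 0 < p ∧ (GenContFract.of α).dens n = p) ∧
      ∃ p : ℕ, 0 < p ∧ (GenContFract.of α).dens (n + 1) = p := by
    intro n
    induction n with
    | zero =>
      obtain ⟨z, hz1, hz⟩ := hs 0
      lift z to ℕ using by omega
      refine ⟨⟨1, one_pos, by simp⟩, ⟨z, by omega, ?_⟩⟩
      rw [zero_add, GenContFract.first_den_eq hz]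
      simp
    | succ n ih =>
      obtain ⟨⟨p, hp0, hp⟩, ⟨p', hp0', hp'⟩⟩ := ih
      obtain ⟨z, hz1, hz⟩ := hs (n + 1)
      lift z to ℕ using by omega
      refine ⟨⟨p', hp0', hp'⟩, ⟨z * p' + p, by positivity, ?_⟩⟩
      rw [GenContFract.dens_recurrence hz hp hp']
      push_cast; ring
  choose P hP using fun n => (hnum n).1
  choose Q hQ0 hQ using fun n => (hden n).1
  refine ⟨P, Q, fun n => ⟨(hQ n).symm, hQ0 n, ?_, ?_, ?_⟩⟩
  · have h := SimpContFract.determinant (s := SimpContFract.of α) (n := n) (hterm n)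
    change (GenContFract.of α).nums n * (GenContFract.of α).dens (n + 1) -
      (GenContFract.of α).dens n * (GenContFract.of α).nums (n + 1) = (-1) ^ (n + 1) at h
    rw [hP, hQ, hP, hQ] at h
    have h' : P n * Q (n + 1) - Q n * P (n + 1) = (-1) ^ (n + 1) := by exact_mod_cast h
    rcases neg_one_pow_eq_or ℤ (n + 1) with h1 | h1
    · exact ⟨Q (n + 1), -P (n + 1), by rw [← h1, ← h']; ring⟩
    · refine ⟨-Q (n + 1), P (n + 1), ?_⟩
      rw [h1] at h'
      linear_combination -h'
  · have h := GenContFract.abs_sub_convs_le (hterm n)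
    rw [GenContFract.conv_eq_num_div_den, hP, hQ, hQ] at h
    have hm := GenContFract.of_den_mono (v := α) (n := n)
    rw [hQ, hQ] at hm
    have hq : (0 : ℝ) < Q n := by exact_mod_cast hQ0 n
    have hq' : (0 : ℝ) < Q (n + 1) := by exact_mod_cast hQ0 (n + 1)
    rw [le_div_iff₀ (by positivity)] at h
    refine le_trans ?_ h
    rw [pow_two]
    gcongr
  · have hm := GenContFract.of_den_mono (v := α) (n := n)
    rw [hQ, hQ] at hm
    obtain ⟨z, hz1, hz⟩ := hs (n + 1)
    have h := GenContFract.dens_recurrence hz (hQ n) (hQ (n + 1))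
    rw [hQ] at h
    have hz' : (1 : ℝ) ≤ z := by exact_mod_cast hz1
    have hq' : (0 : ℝ) < Q (n + 1) := by exact_mod_cast hQ0 (n + 1)
    have : (2 * Q n : ℝ) ≤ Q (n + 2) := by
      rw [h]
      simp only
      nlinarith
    exact_mod_cast this

/-- A multiple of size comparable to the denominator of a convergent brings `α` close to `γ`. -/
theorem exists_multiple_near {α : ℝ} (γ : ℝ) {P : ℤ} {Q : ℕ} (hQ : 0 < Q)
    (hc : IsCoprime P (Q : ℤ)) (h : |α - P / Q| * (Q : ℝ) ^ 2 ≤ 1) :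
    ∃ n : ℕ, Q ≤ n ∧ n ≤ 2 * Q ∧ (n : ℝ) * nint (n * α - γ) ≤ 5 := by
  obtain ⟨u, v, huv⟩ := hc
  have hQz : (0 : ℤ) < Q := by exact_mod_cast hQ
  have hQr : (0 : ℝ) < Q := by exact_mod_cast hQ
  set c : ℤ := round (Q * γ) with hcdef
  have hmod := Int.emod_add_mul_ediv (u * c) Q
  have h0 := Int.emod_nonneg (u * c) hQz.ne'
  have h1 := Int.emod_lt_of_pos (u * c) hQz
  obtain ⟨n, hn⟩ := Int.eq_ofNat_of_zero_le (by linarith : 0 ≤ (u * c) % Q + Q)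
  have hn1 : Q ≤ n := by omega
  have hn2 : n ≤ 2 * Q := by omega
  refine ⟨n, hn1, hn2, ?_⟩
  have hnr2 : (n : ℝ) ≤ 2 * Q := by exact_mod_cast hn2
  obtain ⟨w, hw⟩ : ∃ w : ℤ, (n : ℤ) * P = c + Q * w := by
    refine ⟨P - P * (u * c / Q) - v * c, ?_⟩
    have e : (n : ℤ) = u * c - Q * (u * c / Q) + Q := by
      have : (u * c) % Q = u * c - Q * (u * c / Q) := by linarith
      rw [← this]; exact hn.symm
    rw [e]
    linear_combination c * huv
  have hwr : (n : ℝ) * P = c + Q * w := by exact_mod_cast hw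
  have e : (n : ℝ) * α - γ - w = n * (α - P / Q) + (c - Q * γ) / Q := by
    field_simp
    linear_combination hwr
  have hc2 : |(c : ℝ) - Q * γ| ≤ 1 / 2 := by
    rw [abs_sub_comm, hcdef]; exact abs_sub_round _
  have hb : |(n : ℝ) * α - γ - w| * Q ≤ 5 / 2 := by
    rw [e]
    have h2 : |(n : ℝ) * (α - P / Q) + (c - Q * γ) / Q| ≤ n * |α - P / Q| + 1 / 2 / Q := by
      refine (abs_add_le _ _).trans ?_
      rw [abs_mul, abs_div, abs_of_pos hQr, Nat.abs_cast]
      gcongr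
    have h3 : n * |α - P / Q| * Q ≤ 2 * (|α - P / Q| * (Q : ℝ) ^ 2) := by
      have := mul_le_mul_of_nonneg_right hnr2 (by positivity : 0 ≤ |α - P / Q| * Q)
      linarith
    calc |(n : ℝ) * (α - P / Q) + (c - Q * γ) / Q| * Q
        ≤ (n * |α - P / Q| + 1 / 2 / Q) * Q := by gcongr
      _ = n * |α - P / Q| * Q + 1 / 2 := by field_simp
      _ ≤ 5 / 2 := by linarith
  calc (n : ℝ) * nint (n * α - γ) ≤ 2 * Q * |(n : ℝ) * α - γ - w| := by
        gcongr
        · exact nint_nonneg _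
        · exact nint_le _ _
    _ ≤ 5 := by linarith

/-- A lacunary sequence of at most exponential growth along which `n * ‖n * α - γ‖` stays
bounded. -/
theorem exists_lacunary {α : ℝ} (hα : memK α) (γ : ℝ) :
    ∃ (N : ℕ → ℕ) (R : ℕ), ∀ j, 0 < N j ∧ (N j : ℝ) * nint (N j * α - γ) ≤ 5 ∧
      2 * N j ≤ N (j + 1) ∧ N j ≤ R ^ (j + 1) := by
  obtain ⟨hirr, M, hM⟩ := hα
  obtain ⟨P, Q, hPQ⟩ := exists_convergents hirr
  choose n hn1 hn2 hn3 using fun j => exists_multiple_near γ (hPQ j).2.1 (hPQ j).2.2.1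
    (hPQ j).2.2.2.1
  have hpos : ∀ j, 0 < n j := fun j => (hPQ j).2.1.trans_le (hn1 j)
  refine ⟨fun j => n (4 * j), ⌈2 * exp (4 * |M|)⌉₊, fun j => ⟨hpos _, hn3 _, ?_, ?_⟩⟩
  · have h1 := (hPQ (4 * j)).2.2.2.2
    have h2 := (hPQ (4 * j + 2)).2.2.2.2
    have h3 := hn2 (4 * j)
    have h4 := hn1 (4 * (j + 1))
    have h5 : 4 * (j + 1) = 4 * j + 2 + 2 := by ring
    rw [h5] at h4
    simp only [h5]
    omega
  · have hR : 2 * exp (4 * |M|) ≤ (⌈2 * exp (4 * |M|)⌉₊ : ℝ) := Nat.le_ceil _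
    have hexp : 1 ≤ exp (4 * |M|) := one_le_exp (by positivity)
    have hQj : (Q (4 * j) : ℝ) ≤ exp (4 * |M|) ^ j := by
      rcases Nat.eq_zero_or_pos j with rfl | hj
      · rw [mul_zero, (hPQ 0).1, contDen]; simp
      · have h1 := hM ⟨(⟨4 * j, by omega⟩ : ℕ+), rfl⟩
        have hj' : (0 : ℝ) < ((4 * j : ℕ) : ℝ) := by exact_mod_cast (by omega : 0 < 4 * j)
        simp only [PNat.mk_coe] at h1
        rw [← (hPQ (4 * j)).1, div_le_iff₀ hj',
          Real.log_le_iff_le_exp (by exact_mod_cast (hPQ (4 * j)).2.1)] at h1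
        rw [← exp_nat_mul]
        refine h1.trans (exp_le_exp.2 ?_)
        push_cast
        nlinarith [le_abs_self M, (by positivity : (0 : ℝ) ≤ j)]
    have h2 : (n (4 * j) : ℝ) ≤ 2 * Q (4 * j) := by exact_mod_cast hn2 (4 * j)
    have : (n (4 * j) : ℝ) ≤ (⌈2 * exp (4 * |M|)⌉₊ : ℝ) ^ (j + 1) := by
      calc (n (4 * j) : ℝ) ≤ 2 * exp (4 * |M|) ^ j := by linarith
        _ ≤ 2 * exp (4 * |M|) ^ j * exp (4 * |M|) := le_mul_of_one_le_right (by positivity) hexp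
        _ = 2 * exp (4 * |M|) ^ (j + 1) := by ring
        _ ≤ 2 ^ (j + 1) * exp (4 * |M|) ^ (j + 1) := by
            gcongr; exact le_self_pow₀ (by norm_num) (by omega)
        _ = (2 * exp (4 * |M|)) ^ (j + 1) := by rw [mul_pow]
        _ ≤ _ := by gcongr
    exact_mod_cast this

theorem adm_zero {b : ℕ} (hb : 1 ≤ b) : Adm b 0 0 := by
  intro x _ q hq _ h2 _
  exfalso
  have hb0 : (1 : ℝ) ≤ b := by exact_mod_cast hb
  have hq1 : (1 : ℝ) ≤ q := by exact_mod_cast hq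
  rw [pow_zero, lt_div_iff₀ (by positivity)] at h2
  nlinarith [one_le_pow₀ hq1 (n := 2)]

theorem adm_children {b k : ℕ} (hb : 2048 ≤ b) {a : ℤ} (ha : Adm b k a) [DecidablePred fun i : ℕ =>
      Adm b (k + 1) (b * a + i)] :
    b - 2 ≤ ((Finset.range b).filter fun i : ℕ => Adm b (k + 1) (b * a + i)).card := by
  classical
  have hb0 : (2048 : ℝ) ≤ b := by exact_mod_cast hb
  refine (free_children (k := k) (F := 1 / (3 * b)) (c := 1 / (1344 * b ^ 5)) (by omega)
    (by positivity) ?_ a).trans (Finset.card_le_card ?_)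
  · rw [div_div]
    gcongr 1 / ?_
    have : (1 : ℝ) ≤ b ^ 3 := one_le_pow₀ (by linarith)
    calc 3 * (b : ℝ) * (2 * b) = 6 * b ^ 2 * 1 := by ring
      _ ≤ 1344 * b ^ 2 * b ^ 3 := by gcongr; norm_num
      _ = 1344 * b ^ 5 := by ring
  · intro i hi
    rw [Finset.mem_filter] at hi ⊢
    have hib := Finset.mem_range.1 hi.1
    refine ⟨hi.1, fun x hx => ?_⟩
    have h1 : x ∈ Node b k a :=
      node_sub_of_ediv (j := 1) (by omega) (by rw [pow_one, child_ediv hib]) hx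
    refine (ha x h1).union ((hi.2 x hx).mono le_rfl ?_ ?_)
    · exact le_of_eq (by ring)
    · exact le_of_eq (by rw [pow_succ]; field_simp)

theorem mem_bad_of_badOn {x c : ℝ} (hc : 0 < c) (h : ∀ n : ℕ, ∃ hi : ℝ, (n : ℝ) ^ 2 < hi ∧
    BadOn c 0 hi x) : x ∈ Bad := by
  refine ⟨c, hc, fun n hn => ?_⟩
  have hn0 : (0 : ℝ) < n := by exact_mod_cast hn
  obtain ⟨hi, h1, h2⟩ := h n
  rw [mul_comm, ← div_le_iff₀ hn0]
  refine le_ciInf fun p => ?_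
  rw [div_le_iff₀ hn0, mul_comm]
  exact h2 n hn (by positivity) h1 p

/-- Blocks `[s i, s i + r i)` separated by long gaps occupy a small proportion of every initial
segment. -/
theorem card_blocks_le {b : ℕ} {s r : ℕ → ℕ} (h0 : b * r 0 ≤ s 0)
    (hstep : ∀ i, s i + r i + b * r (i + 1) ≤ s (i + 1))
    (p : ℕ → Prop) [DecidablePred p] (hp : ∀ k, p k → ∃ i, s i ≤ k ∧ k < s i + r i) (K : ℕ) :
    b * ((Finset.range K).filter p).card ≤ K := by
  have hmono : Monotone s := monotone_nat_of_le_succ fun i => by have := hstep i; omega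
  have hemono : Monotone fun i => s i + r i :=
    monotone_nat_of_le_succ fun i => by have := hstep i; omega
  have hF : ∀ i, b * ((Finset.range (s i + r i)).filter p).card ≤ s i := by
    intro i
    induction i with
    | zero =>
      refine le_trans (Nat.mul_le_mul_left b ?_) h0
      have : (Finset.range (s 0 + r 0)).filter p ⊆ Finset.Ico (s 0) (s 0 + r 0) := by
        intro k hk
        rw [Finset.mem_filter, Finset.mem_range] at hk
        obtain ⟨i, h1, -⟩ := hp k hk.2
        exact Finset.mem_Ico.2 ⟨(hmono (Nat.zero_le i)).trans h1, hk.1⟩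
      simpa using Finset.card_le_card this
    | succ i ih =>
      have hsub : (Finset.range (s (i + 1) + r (i + 1))).filter p ⊆
          (Finset.range (s i + r i)).filter p ∪
            Finset.Ico (s (i + 1)) (s (i + 1) + r (i + 1)) := by
        intro k hk
        rw [Finset.mem_filter, Finset.mem_range] at hk
        rw [Finset.mem_union, Finset.mem_filter, Finset.mem_range, Finset.mem_Ico]
        obtain ⟨j, h1, h2⟩ := hp k hk.2
        rcases Nat.lt_or_ge i j with h | h
        · exact Or.inr ⟨(hmono h).trans h1, hk.1⟩
        · exact Or.inl ⟨h2.trans_le (hemono h), hk.2⟩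
      have hc := (Finset.card_le_card hsub).trans (Finset.card_union_le _ _)
      rw [Nat.card_Ico, Nat.add_sub_cancel_left] at hc
      have h1 := Nat.mul_le_mul_left b hc
      rw [mul_add] at h1
      have h2 := hstep i
      omega
  have key : ∀ i, K ≤ s i → b * ((Finset.range K).filter p).card ≤ K := by
    intro i
    induction i with
    | zero =>
      intro hK
      have : (Finset.range K).filter p = ∅ := by
        refine Finset.filter_eq_empty_iff.2 fun k hk hpk => ?_
        obtain ⟨j, h1, -⟩ := hp k hpk
        have := hmono (Nat.zero_le j)
        have := Finset.mem_range.1 hk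
        omega
      simp [this]
    | succ i ih =>
      intro hK
      rcases Nat.lt_or_ge (s i) K with h | h
      · refine le_trans (Nat.mul_le_mul_left b (Finset.card_le_card ?_)) ((hF i).trans h.le)
        intro k hk
        rw [Finset.mem_filter, Finset.mem_range] at hk ⊢
        obtain ⟨j, h1, h2⟩ := hp k hk.2
        have hji : j ≤ i := by
          by_contra hcon
          have := hmono (by omega : i + 1 ≤ j)
          omega
        exact ⟨h2.trans_le (hemono hji), hk.2⟩
      · exact ih h
  by_cases hr : ∃ i, K ≤ s i
  · obtain ⟨i, hi⟩ := hr
    exact key i hi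
  · push Not at hr
    have hbdd : ∃ i, ∀ k ∈ (Finset.range K).filter p, k < s i + r i := by
      have : ∀ T : Finset ℕ, (∀ k ∈ T, p k) → ∃ i, ∀ k ∈ T, k < s i + r i := by
        classical
        intro T
        induction T using Finset.induction_on with
        | empty => exact fun _ => ⟨0, by simp⟩
        | insert k T _ ih =>
          intro hT
          obtain ⟨i, hi⟩ := ih fun k hk => hT k (Finset.mem_insert_of_mem hk)
          obtain ⟨j, -, hj⟩ := hp k (hT k (Finset.mem_insert_self _ _))
          refine ⟨max i j, fun l hl => ?_⟩
          rcases Finset.mem_insert.1 hl with rfl | hl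
          · exact hj.trans_le (hemono (le_max_right _ _))
          · exact (hi l hl).trans_le (hemono (le_max_left _ _))
      exact this _ fun k hk => (Finset.mem_filter.1 hk).2
    obtain ⟨i, hi⟩ := hbdd
    have : (Finset.range K).filter p ⊆ (Finset.range (s i + r i)).filter p := by
      intro k hk
      exact Finset.mem_filter.2 ⟨Finset.mem_range.2 (hi k hk), (Finset.mem_filter.1 hk).2⟩
    have h1 := Nat.mul_le_mul_left b (Finset.card_le_card this)
    have h2 := hF i
    have h3 := hr i
    omega

theorem rpow_le_prod_ite {b K : ℕ} (hb : 4 ≤ b) (p : ℕ → Prop) [DecidablePred p]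
    (h : b * ((Finset.range K).filter p).card ≤ K) :
    (b : ℝ) ^ ((1 - 1 / (b : ℝ)) * (log (b - 2) / log b) * K) ≤
      ((∏ k ∈ Finset.range K, if p k then 1 else b - 2 : ℕ) : ℝ) := by
  have hb0 : (4 : ℝ) ≤ b := by exact_mod_cast hb
  have hlog : 0 < log b := log_pos (by linarith)
  rw [Finset.prod_ite, Finset.prod_const_one, one_mul, Finset.prod_const]
  have hcard := Finset.card_filter_add_card_filter_not (s := Finset.range K) p
  rw [Finset.card_range] at hcard
  rw [Nat.cast_pow, Nat.cast_sub (by omega), ← rpow_natCast, rpow_def_of_pos (by linarith),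
    rpow_def_of_pos (by push_cast; linarith)]
  refine exp_le_exp.2 ?_
  have e : log (b : ℝ) * ((1 - 1 / (b : ℝ)) * (log (b - 2) / log b) * K) =
      log (b - 2) * (K - K / b) := by field_simp
  rw [e]
  push_cast
  refine mul_le_mul_of_nonneg_left ?_ (log_nonneg (by linarith))
  have h1 : (((Finset.range K).filter p).card : ℝ) ≤ K / b := by
    rw [le_div_iff₀ (by linarith), mul_comm]
    exact_mod_cast h
  have h2 : (((Finset.range K).filter p).card : ℝ) +
    ((Finset.range K).filter fun k => ¬ p k).card = K := by exact_mod_cast hcard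
  linarith

theorem exists_stage_set {b : ℕ} (hb : 2048 ≤ b) {u s : ℕ → ℕ} (hu : ∀ i, 50 ≤ u i)
    (h0 : b * (49 * u 0 + 2) ≤ s 0)
    (hstep : ∀ i, s i + (49 * u i + 2) + b * (49 * u (i + 1) + 2) ≤ s (i + 1))
    {m t : ℕ → ℝ} (hm1 : ∀ i, (b : ℝ) ^ (s i + 48 * u i) ≤ m i)
    (hm2 : ∀ i, m i ≤ (b : ℝ) ^ (s i + 48 * u i + 1)) :
    ∃ E ⊆ Bad, ENNReal.ofReal ((1 - 1 / (b : ℝ)) * (log (b - 2) / log b)) ≤ dimH E ∧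
      ∀ x ∈ E, ∀ i, ∃ j : ℤ, |m i * x - t i - j| ≤ 2 / (b : ℝ) ^ u i := by
  classical
  have hb0 : (2048 : ℝ) ≤ b := by exact_mod_cast hb
  have hbZ : (0 : ℤ) < b := by omega
  set e : ℕ → ℕ := fun i => s i + (49 * u i + 2) with he
  have hse : ∀ i, s i < e i := fun i => by simp only [he]; omega
  have hes : ∀ i, e i ≤ s (i + 1) := fun i => le_trans (Nat.le_add_right _ _) (hstep i)
  have hsmono : Monotone s := monotone_nat_of_le_succ fun i => (hse i).le.trans (hes i)
  have hdisj : ∀ {i j}, i < j → e i ≤ s j := fun {i j} hij => (hes i).trans (hsmono hij)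
  have hus : ∀ i, 9 * u i ≤ s i := by
    intro i
    have hmul : ∀ v : ℕ, 9 * v ≤ b * (49 * v + 2) := fun v =>
      (by omega : 9 * v ≤ 1 * (49 * v + 2)).trans (Nat.mul_le_mul_right _ (by omega))
    rcases i with _ | i
    · exact (hmul _).trans h0
    · exact (hmul _).trans (le_trans (Nat.le_add_left _ _) (hstep i))
  set Target : ℕ → ℤ → Prop := fun i a => Adm b (e i) a ∧ ∀ x ∈ Node b (e i) a,
    ∃ j : ℤ, |m i * x - t i - j| ≤ 2 / (b : ℝ) ^ u i with hTarget
  set Good : ℕ → ℤ → Prop := fun k a =>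
    (∀ i, s i < k → k ≤ e i → ∃ a' : ℤ, a' / (b : ℤ) ^ (e i - k) = a ∧ Target i a') ∧
    ((∀ i, ¬(s i < k ∧ k < e i)) → Adm b k a) with hGood
  set Forced : ℕ → Prop := fun k => ∃ i, s i ≤ k ∧ k < e i with hForced
  have hstepGood : ∀ k a, Good k a → (if Forced k then 1 else b - 2) ≤
      ((Finset.range b).filter fun i : ℕ => Good (k + 1) (b * a + i)).card := by
    intro k a hka
    split_ifs with hf
    · obtain ⟨i, hi1, hi2⟩ := hf
      have htarget : ∃ a' : ℤ, a' / (b : ℤ) ^ (e i - k) = a ∧ Target i a' := by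
        rcases hi1.eq_or_lt with hi | hi
        · have hadm : Adm b k a := by
            refine hka.2 fun j hj => ?_
            rcases lt_trichotomy j i with h | h | h
            · have := hdisj h; omega
            · subst h; omega
            · have := hdisj h; omega
          subst hi
          obtain ⟨a', h1, h2, h3⟩ := exists_hit hb (hu i) (hus i) hadm (hm1 i) (hm2 i) (t i)
          refine ⟨a', ?_, h2, h3⟩
          rwa [show e i - s i = 49 * u i + 2 by simp only [he]; omega]
        · exact hka.1 i hi hi2.le
      obtain ⟨a', ha', hT⟩ := htarget
      set c := a' / (b : ℤ) ^ (e i - (k + 1)) with hc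
      have hcb : c / b = a := by
        rw [hc, Int.ediv_ediv_of_nonneg (by positivity), ← pow_succ, ← ha']
        congr 2
        omega
      have hmod : ((c % b).toNat : ℤ) = c % b := Int.toNat_of_nonneg (Int.emod_nonneg _ hbZ.ne')
      have hceq : b * a + ((c % b).toNat : ℤ) = c := by
        rw [hmod, ← hcb]
        exact Int.mul_ediv_add_emod c b
      refine Finset.card_pos.2 ⟨(c % b).toNat, Finset.mem_filter.2 ⟨Finset.mem_range.2 ?_, ?_⟩⟩
      · have := Int.emod_lt_of_pos c hbZ
        omega
      rw [hceq]
      refine ⟨fun j hj1 hj2 => ?_, fun h => ?_⟩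
      · obtain rfl : j = i := by
          rcases lt_trichotomy j i with h | h | h
          · have := hdisj h; omega
          · exact h
          · have := hdisj h; omega
        exact ⟨a', rfl, hT⟩
      · have hke : k + 1 = e i := by
          have := h i
          omega
        have : c = a' := by rw [hc, hke]; simp
        rw [this, hke]
        exact hT.1
    · have hadm : Adm b k a := hka.2 fun j hj => hf ⟨j, hj.1.le, hj.2⟩
      refine (adm_children hb hadm).trans (Finset.card_le_card ?_)
      intro c hc
      rw [Finset.mem_filter] at hc ⊢
      exact ⟨hc.1, fun j h1 h2 => (hf ⟨j, by omega, by omega⟩).elim, fun _ => hc.2⟩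
  have hend : ∀ x, (∀ k, ∃ a, Good k a ∧ x ∈ Node b k a) → ∀ i, ∃ a, Target i a ∧
      x ∈ Node b (e i) a := by
    intro x hx i
    obtain ⟨a, ha, hxa⟩ := hx (e i)
    obtain ⟨a', h1, h2⟩ := ha.1 i (hse i) le_rfl
    rw [Nat.sub_self, pow_zero, Int.ediv_one] at h1
    subst h1
    exact ⟨a', h2, hxa⟩
  have hege : ∀ i, i ≤ e i := by
    intro i
    induction i with
    | zero => exact Nat.zero_le _
    | succ i ih => have := hes i; have := hse (i + 1); omega
  have hb2 : 0 < log (b - 2 : ℝ) := log_pos (by linarith)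
  refine ⟨{x | ∀ k, ∃ a, Good k a ∧ x ∈ Node b k a}, fun x hx => ?_, ?_, fun x hx i => ?_⟩
  · refine mem_bad_of_badOn (c := 1 / (1344 * (b : ℝ) ^ 5)) (by positivity) fun n => ?_
    obtain ⟨a, ha, hxa⟩ := hend x hx (3 * b * n ^ 2 + 1)
    refine ⟨_, ?_, ha.1 x hxa⟩
    rw [lt_div_iff₀ (by positivity)]
    have h1 : 3 * b * n ^ 2 + 1 < b ^ e (3 * b * n ^ 2 + 1) :=
      (hege _).trans_lt (Nat.lt_pow_self (by omega))
    have h2 : (3 * b * n ^ 2 + 1 : ℝ) < (b : ℝ) ^ e (3 * b * n ^ 2 + 1) := by exact_mod_cast h1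
    linarith
  · refine le_dimH_of_tree (by omega) Good (fun k => if Forced k then 1 else b - 2)
      (fun k => ?_) 0 ⟨fun i hi => by omega, fun _ => adm_zero (by omega)⟩
      (fun k a h => (hstepGood k a h).trans (le_of_eq (by congr))) (C := 1) ?_ fun K => ?_
    · split_ifs <;> omega
    · have h1 : 1 / (b : ℝ) < 1 := by rw [div_lt_one] <;> linarith
      have h2 : 0 < log (b : ℝ) := log_pos (by linarith)
      have := div_pos hb2 h2
      exact mul_pos (by linarith) this
    · rw [one_mul]
      exact rpow_le_prod_ite (by omega) Forced
        (card_blocks_le (r := fun i => 49 * u i + 2) h0 hstep Forced (fun k hk => hk) K)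
  · obtain ⟨a, ha, hxa⟩ := hend x hx i
    exact ha.2 x hxa

theorem exists_set_of_lacunary {b : ℕ} (hb : 2048 ≤ b) {N : ℕ → ℕ} (hpos : ∀ j, 0 < N j)
    (hN : ∀ j, 2 * N j ≤ N (j + 1)) :
    ∃ A : ℕ, ∃ E ⊆ Bad, ENNReal.ofReal ((1 - 1 / (b : ℝ)) * (log (b - 2) / log b)) ≤ dimH E ∧
      ∀ x ∈ E, ∀ δ : ℝ, ∀ U : ℕ, 50 ≤ U → ∃ k : ℕ, b ^ U ≤ k ∧ k ≤ A * U * b ^ U ∧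
        nint (N k * x - δ) ≤ 3 / (b : ℝ) ^ U := by
  have hb0 : (0 : ℝ) < b := by positivity
  have hgrow : ∀ j d, 2 ^ d * N j ≤ N (j + d) := by
    intro j d
    induction d with
    | zero => simp
    | succ d ih => rw [pow_succ, ← add_assoc]; linarith [hN (j + d)]
  have hNmono : Monotone N := monotone_nat_of_le_succ fun j => by linarith [hN j]
  set B : ℕ := 51 * (b + 1) with hB
  have hgrow' : ∀ j v, b ^ (B * v) * N j ≤ N (j + b * B * v) := fun j v => by
    refine le_trans (Nat.mul_le_mul_right _ ?_) (hgrow j _)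
    rw [mul_assoc b, pow_mul 2]
    exact Nat.pow_le_pow_left Nat.lt_two_pow_self.le _
  set u : ℕ → ℕ := fun i => Nat.log b (i + b ^ 50) with hudef
  have humono : ∀ i, u i ≤ u (i + 1) := fun i => Nat.log_mono_right (by omega)
  have hu : ∀ i, 50 ≤ u i := fun i => by
    exact Nat.le_log_of_pow_le (by omega) (by omega)
  set κ : ℕ → ℕ := fun i => b * B * u i * (i + b ^ 50) with hκ
  set L : ℕ → ℕ := fun i => Nat.log b (N (κ i)) with hL
  have hLpow : ∀ i, b ^ L i ≤ N (κ i) := fun i => Nat.pow_log_le_self b (hpos _).ne'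
  have hLge : ∀ i, B * u i ≤ L i := fun i => by
    refine Nat.le_log_of_pow_le (by omega) ?_
    have h1 := hgrow' 0 (u i)
    have h2 := Nat.mul_le_mul_left (b ^ (B * u i)) (hpos 0)
    rw [Nat.succ_eq_add_one, zero_add, mul_one] at h2
    refine (h2.trans h1).trans (hNmono ?_)
    rw [zero_add]
    exact Nat.le_mul_of_pos_right _ (by positivity)
  have hLstep : ∀ i, L i + B * u (i + 1) ≤ L (i + 1) := fun i => by
    refine Nat.le_log_of_pow_le (by omega) ?_
    rw [add_comm, pow_add]
    refine (Nat.mul_le_mul_left _ (hLpow i)).trans ((hgrow' _ _).trans (hNmono ?_))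
    have := Nat.mul_le_mul_left (b * B) (Nat.mul_le_mul_right (i + b ^ 50) (humono i))
    simp only [hκ]
    calc b * B * u i * (i + b ^ 50) + b * B * u (i + 1)
        ≤ b * B * (u (i + 1) * (i + b ^ 50)) + b * B * u (i + 1) := by
          rw [mul_assoc (b * B)]; omega
      _ = b * B * u (i + 1) * (i + 1 + b ^ 50) := by ring
  have hBu : ∀ v, 50 ≤ v → b * (49 * v + 2) + 49 * v + 2 ≤ B * v := fun v hv => by
    rw [hB]
    nlinarith
  have hsL : ∀ i, L i - 48 * u i + 48 * u i = L i := fun i => by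
    have h1 := hLge i
    have h2 := hBu _ (hu i)
    omega
  obtain ⟨E, hE, hdim, hhit⟩ := exists_stage_set hb (u := u) (s := fun i => L i - 48 * u i) hu
    (by have h1 := hLge 0
        have h2 := hBu _ (hu 0)
        omega)
    (fun i => by
      have h1 := hLstep i
      have h2 := hBu _ (hu (i + 1))
      have h3 := humono i
      have h4 := hsL i
      have h5 := hsL (i + 1)
      omega)
    (m := fun i => N (κ i)) (t := fun i => ((i + b ^ 50 : ℕ) : ℝ) / (b : ℝ) ^ u i)
    (fun i => by rw [hsL]; exact_mod_cast hLpow i)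
    (fun i => by
      rw [hsL]
      exact_mod_cast (Nat.lt_pow_succ_log_self (by omega) _).le)
  refine ⟨2 * (b * B), E, hE, hdim, fun x hx δ U hU => ?_⟩
  set r : ℕ := ⌊Int.fract δ * (b : ℝ) ^ U⌋₊ with hr
  have hbU : (0 : ℝ) < (b : ℝ) ^ U := by positivity
  have hr0 : 0 ≤ Int.fract δ * (b : ℝ) ^ U := mul_nonneg (Int.fract_nonneg δ) hbU.le
  have hr1 : (r : ℝ) ≤ Int.fract δ * (b : ℝ) ^ U := Nat.floor_le hr0
  have hr2 : Int.fract δ * (b : ℝ) ^ U < r + 1 := Nat.lt_floor_add_one _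
  have hrlt : r < b ^ U := by
    have : (r : ℝ) < (b : ℝ) ^ U := by nlinarith [Int.fract_lt_one δ]
    exact_mod_cast this
  have hpow : b ^ 50 ≤ b ^ U := Nat.pow_le_pow_right (by omega) hU
  set i : ℕ := b ^ U + r - b ^ 50 with hi
  have hI : i + b ^ 50 = b ^ U + r := by omega
  have hui : u i = U := by
    simp only [hudef]
    rw [hI]
    refine Nat.log_eq_of_pow_le_of_lt_pow (by omega) ?_
    rw [pow_succ]
    nlinarith
  have hκi : κ i = b * B * U * (b ^ U + r) := by simp only [hκ]; rw [hui, hI]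
  refine ⟨κ i, ?_, ?_, ?_⟩
  · rw [hκi]
    have : 1 ≤ b * B * U := Nat.one_le_iff_ne_zero.2 (by positivity)
    nlinarith
  · rw [hκi]
    calc b * B * U * (b ^ U + r) ≤ b * B * U * (b ^ U + b ^ U) := by gcongr
      _ = 2 * (b * B) * U * b ^ U := by ring
  · obtain ⟨j, hj⟩ := hhit x hx i
    rw [hui, hI] at hj
    refine (nint_le _ (j + 1 - ⌊δ⌋)).trans ?_
    have e : (N (κ i) : ℝ) * x - δ - ((j + 1 - ⌊δ⌋ : ℤ) : ℝ) =
        (N (κ i) * x - ((b ^ U + r : ℕ) : ℝ) / (b : ℝ) ^ U - j) +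
          (r - Int.fract δ * (b : ℝ) ^ U) / (b : ℝ) ^ U := by
      rw [Int.fract]
      push_cast
      field_simp
      ring
    have h2 : |(r - Int.fract δ * (b : ℝ) ^ U) / (b : ℝ) ^ U| ≤ 1 / (b : ℝ) ^ U := by
      rw [abs_div, abs_of_pos hbU]
      gcongr
      rw [abs_le]
      constructor <;> linarith
    rw [e]
    refine (abs_add_le _ _).trans ((add_le_add hj h2).trans (le_of_eq ?_))
    rw [← add_div]
    norm_num

theorem frequently_lt_of_lacunary {b : ℕ} (hb : 2048 ≤ b) {N : ℕ → ℕ} {A R : ℕ}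
    (hpos : ∀ j, 0 < N j) (hN : ∀ j, 2 * N j ≤ N (j + 1)) (hR : ∀ j, N j ≤ R ^ (j + 1))
    {f : ℕ → ℝ} {ε : ℝ} (hε : 0 < ε)
    (hf : ∀ U : ℕ, 50 ≤ U → ∃ k : ℕ, b ^ U ≤ k ∧ k ≤ A * U * b ^ U ∧
      f (N k) ≤ 15 / (b : ℝ) ^ U) :
    Set.Infinite {n : ℕ | 0 < n ∧ f n < log (log n) ^ ((3 : ℝ) + ε) / log n} := by
  have hb0 : (2048 : ℝ) ≤ b := by exact_mod_cast hb
  have hgrow : ∀ j, 2 ^ j ≤ N j := by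
    intro j
    induction j with
    | zero => exact hpos 0
    | succ j ih => rw [pow_succ]; linarith [hN j]
  refine Set.infinite_of_forall_exists_gt fun n₀ => ?_
  set C : ℝ := (A + 1) * log R with hC
  obtain ⟨U₁, hU₁⟩ := exists_nat_gt (15 * C)
  set U : ℕ := 50 + n₀ + U₁ with hU
  obtain ⟨k, hk1, hk2, hk3⟩ := hf U (by omega)
  have hNk : U < N k := by
    have h1 : U < b ^ U := Nat.lt_pow_self (by omega)
    have h2 : k < 2 ^ k := Nat.lt_two_pow_self
    exact (h1.trans_le hk1).trans (h2.trans_le (hgrow k))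
  have hbU : (0 : ℝ) < (b : ℝ) ^ U := by positivity
  have hU50 : (50 : ℝ) ≤ U := by exact_mod_cast (by omega : 50 ≤ U)
  have hUC : 15 * C < U := hU₁.trans_le (by exact_mod_cast (by omega : U₁ ≤ U))
  have hloglow : exp U ≤ log (N k) := by
    have h1 : (2 : ℝ) ^ k ≤ N k := by exact_mod_cast hgrow k
    have h2 := log_le_log (by positivity) h1
    rw [log_pow] at h2
    have h3 : (b : ℝ) ^ U ≤ k := by exact_mod_cast hk1
    have h4 : exp 1 ^ U * 2 ≤ (b : ℝ) ^ U := by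
      calc exp 1 ^ U * 2 ≤ 3 ^ U * 2 ^ U := by
            gcongr
            · exact exp_one_lt_three.le
            · exact le_self_pow₀ (by norm_num) (by omega)
        _ = 6 ^ U := by rw [← mul_pow]; norm_num
        _ ≤ (b : ℝ) ^ U := by gcongr; linarith
    rw [← exp_nat_mul, mul_one] at h4
    have h5 := log_two_gt_d9
    nlinarith [exp_pos (U : ℝ)]
  have hlogpos : 0 < log (N k) := (exp_pos _).trans_le hloglow
  have hloglog : (U : ℝ) ≤ log (log (N k)) := (le_log_iff_exp_le hlogpos).2 hloglow
  have hlogup : log (N k) ≤ C * U * (b : ℝ) ^ U := by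
    have hR1 : (1 : ℝ) ≤ R := by
      have := (hpos 0).trans_le (hR 0)
      rw [zero_add, pow_one] at this
      exact_mod_cast this
    have h1 : (N k : ℝ) ≤ (R : ℝ) ^ (k + 1) := by exact_mod_cast hR k
    have h2 := log_le_log (by exact_mod_cast hpos k) h1
    rw [log_pow] at h2
    refine h2.trans ?_
    have h3 : k + 1 ≤ (A + 1) * U * b ^ U := by
      have : 1 ≤ U * b ^ U := Nat.one_le_iff_ne_zero.2 (by positivity)
      nlinarith
    have h4 : ((k + 1 : ℕ) : ℝ) ≤ (A + 1) * U * (b : ℝ) ^ U := by exact_mod_cast h3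
    calc ((k + 1 : ℕ) : ℝ) * log R ≤ (A + 1) * U * (b : ℝ) ^ U * log R :=
          mul_le_mul_of_nonneg_right h4 (log_nonneg hR1)
      _ = C * U * (b : ℝ) ^ U := by rw [hC]; ring
  refine ⟨N k, ⟨hpos k, hk3.trans_lt ?_⟩, by omega⟩
  rw [div_lt_div_iff₀ hbU hlogpos]
  have hpow : (U : ℝ) ^ 3 ≤ log (log (N k)) ^ ((3 : ℝ) + ε) := by
    calc (U : ℝ) ^ 3 = (U : ℝ) ^ (3 : ℝ) := by norm_cast
      _ ≤ (U : ℝ) ^ ((3 : ℝ) + ε) := rpow_le_rpow_of_exponent_le (by linarith) (by linarith)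
      _ ≤ _ := rpow_le_rpow (by linarith) hloglog (by linarith)
  calc 15 * log (N k) ≤ 15 * (C * U * (b : ℝ) ^ U) := by linarith
    _ = 15 * C * U * (b : ℝ) ^ U := by ring
    _ < U * U * (b : ℝ) ^ U := by gcongr
    _ ≤ U ^ 3 * (b : ℝ) ^ U := by gcongr; nlinarith
    _ ≤ _ := by gcongr

theorem tendsto_dimension_bound :
    Filter.Tendsto (fun b : ℕ => (1 - 1 / (b : ℝ)) * (log (b - 2) / log b)) Filter.atTop
      (nhds 1) := by
  have hlog : Filter.Tendsto (fun b : ℕ => log (b : ℝ)) Filter.atTop Filter.atTop :=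
    tendsto_log_atTop.comp tendsto_natCast_atTop_atTop
  have h1 : Filter.Tendsto (fun b : ℕ => 1 - 1 / (b : ℝ)) Filter.atTop (nhds (1 - 0)) :=
    tendsto_const_nhds.sub tendsto_one_div_atTop_nhds_zero_nat
  have h2 : Filter.Tendsto (fun b : ℕ => 1 - log 2 / log (b : ℝ)) Filter.atTop (nhds (1 - 0)) :=
    tendsto_const_nhds.sub (tendsto_const_nhds.div_atTop hlog)
  have h3 : Filter.Tendsto (fun b : ℕ => log (b - 2) / log (b : ℝ)) Filter.atTop (nhds 1) := by
    rw [sub_zero] at h2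
    refine tendsto_of_tendsto_of_tendsto_of_le_of_le' h2 tendsto_const_nhds ?_ ?_
    · filter_upwards [Filter.eventually_ge_atTop 4] with b hb
      have hb0 : (4 : ℝ) ≤ b := by exact_mod_cast hb
      have hl : 0 < log (b : ℝ) := log_pos (by linarith)
      rw [one_sub_div hl.ne', ← log_div (by linarith) (by norm_num)]
      gcongr
      linarith
    · filter_upwards [Filter.eventually_ge_atTop 4] with b hb
      have hb0 : (4 : ℝ) ≤ b := by exact_mod_cast hb
      rw [div_le_one (log_pos (by linarith))]
      exact log_le_log (by linarith) (by linarith)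
  simpa using h1.mul h3

theorem littlewood_bad (ε : ℝ) (hε : 0 < ε) (α : ℝ) (hα : memK α) (γ : ℝ) :
    ∃ G : Set ℝ, G ⊆ Bad ∧ dimH G = 1 ∧
      ∀ β ∈ G, ∀ δ : ℝ,
        Set.Infinite {n : ℕ | 0 < n ∧ (n : ℝ) * nint (n * α - γ) * nint (n * β - δ) <
          Real.log (Real.log n) ^ ((3 : ℝ) + ε) / Real.log n} := by
  obtain ⟨N, R, hNR⟩ := exists_lacunary hα γ
  have hE : ∀ b : ℕ, ∃ E ⊆ Bad, (2048 ≤ b →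
      ENNReal.ofReal ((1 - 1 / (b : ℝ)) * (log (b - 2) / log b)) ≤ dimH E) ∧
      ∀ β ∈ E, ∀ δ : ℝ,
        Set.Infinite {n : ℕ | 0 < n ∧ (n : ℝ) * nint (n * α - γ) * nint (n * β - δ) <
          log (log n) ^ ((3 : ℝ) + ε) / log n} := by
    intro b
    by_cases hb : 2048 ≤ b
    · obtain ⟨A, E, hE, hdim, hhit⟩ := exists_set_of_lacunary hb (fun j => (hNR j).1)
        fun j => (hNR j).2.2.1
      refine ⟨E, hE, fun _ => hdim, fun β hβ δ => ?_⟩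
      refine frequently_lt_of_lacunary (A := A) (R := R) hb (fun j => (hNR j).1)
        (fun j => (hNR j).2.2.1) (fun j => (hNR j).2.2.2)
        (f := fun n => (n : ℝ) * nint (n * α - γ) * nint (n * β - δ)) hε fun U hU => ?_
      obtain ⟨k, h1, h2, h3⟩ := hhit β hβ δ U hU
      refine ⟨k, h1, h2, ?_⟩
      calc (N k : ℝ) * nint (N k * α - γ) * nint (N k * β - δ)
          ≤ 5 * (3 / (b : ℝ) ^ U) :=
            mul_le_mul (hNR k).2.1 h3 (nint_nonneg _) (by norm_num)
        _ = 15 / (b : ℝ) ^ U := by ring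
    · exact ⟨∅, empty_subset _, fun h => (hb h).elim, fun β hβ => hβ.elim⟩
  choose E hbad hdim hinf using hE
  refine ⟨⋃ b, E b, iUnion_subset hbad, le_antisymm ?_ ?_, fun β hβ => ?_⟩
  · exact (dimH_mono (subset_univ _)).trans_eq Real.dimH_univ
  · rw [dimH_iUnion]
    have hlim := ENNReal.tendsto_ofReal tendsto_dimension_bound
    rw [ENNReal.ofReal_one] at hlim
    refine le_of_tendsto hlim ?_
    filter_upwards [Filter.eventually_ge_atTop 2048] with b hb
    exact (hdim b hb).trans (le_iSup (fun b => dimH (E b)) b)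
  · obtain ⟨b, hb⟩ := mem_iUnion.1 hβ
    exact hinf b β hb
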